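/- arXiv:2001.09904 — 3 statements merged into one kernel-verified Lean document; each statement's English description precedes it below -/
import Mathlib

section
/- The ∀-amalgamation property fails for finitely generated elementary free groups: there exist finitely generated nonabelian free groups A₀, A₁, A₂ and ∀-embeddings f₁ : A₀ → A₁ and f₂ : A₀ → A₂ such that there is no finitely generated elementary free group B admitting ∀-embeddings g₁ : A₁ → B and g₂ : A₂ → B with g₁ ∘ f₁ = g₂ ∘ f₂. In particular, the class of finitely generated elementary free groups is not a ∀-Fraïssé class. -/
open FirstOrder

/-- Function symbols of the first-order language of groups: a constant for the identity,
a unary symbol for inversion, and a binary symbol for multiplication. -/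
inductive GroupFn : ℕ → Type
  | one : GroupFn 0
  | inv : GroupFn 1
  | mul : GroupFn 2

/-- The first-order language of groups. -/
def Lgp : Language := ⟨GroupFn, fun _ => Empty⟩

/-- Every group is an `Lgp`-structure in the natural way. -/
instance (priority := 100) groupLgpStructure (G : Type*) [Group G] : Lgp.Structure G where
  funMap {_} f x :=
    match f with
    | .one => 1
    | .inv => (x 0)⁻¹
    | .mul => x 0 * x 1
  RelMap {_} r := Empty.elim r

/-- A formula is universal if it is (syntactically) a block of universal quantifiers applied
to a quantifier-free formula. -/
def IsUniversalF {α : Type*} (φ : Lgp.Formula α) : Prop :=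
  ∃ (n : ℕ) (ψ : Lgp.BoundedFormula α n), ψ.IsQF ∧ φ = ψ.alls

/-- A group homomorphism is a `∀`-embedding if it is injective and preserves all universal
formulas (on all finite tuples). -/
def IsForallEmbedding {A B : Type*} [Group A] [Group B] (f : A →* B) : Prop :=
  Function.Injective f ∧
    ∀ (k : ℕ) (φ : Lgp.Formula (Fin k)), IsUniversalF φ →
      ∀ a : Fin k → A, φ.Realize a → φ.Realize (f ∘ a)

/-- A bundled group, used to quantify over groups. -/
structure BGroup where
  carrier : Type
  [str : Group carrier]

attribute [instance] BGroup.str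

instance : CoeSort BGroup Type := ⟨BGroup.carrier⟩

/-- A group is nonabelian if some pair of its elements does not commute. -/
def Nonabelian (G : Type*) [Group G] : Prop :=
  ∃ x y : G, x * y ≠ y * x

/-- A group is elementary free if it is elementarily equivalent, as an `Lgp`-structure, to the
free group of rank 2. -/
def IsElementaryFree (G : Type*) [Group G] : Prop :=
  Lgp.ElementarilyEquivalent G (FreeGroup (Fin 2))


section
namespace FAP

/-- free abelian-type free groups are cyclic -/
theorem isCyclic_of_free_comm (H : Type) [Group H] [IsFreeGroup H]
    (hc : ∀ a b : H, a * b = b * a) : IsCyclic H := by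
  have hsub : ∀ i j : IsFreeGroup.Generators H, i = j := by
    intro i j
    classical
    by_contra hne
    have h := hc (IsFreeGroup.of i) (IsFreeGroup.of j)
    have h2 := congrArg (IsFreeGroup.toFreeGroup H) h
    simp only [map_mul] at h2
    have key : ∀ k, IsFreeGroup.toFreeGroup H (IsFreeGroup.of k) = FreeGroup.of k := by
      intro k
      exact (IsFreeGroup.basis H).repr_apply_coe k
    rw [key, key] at h2
    have h3 := congrArg FreeGroup.toWord h2
    simp [FreeGroup.toWord_mul, FreeGroup.reduce.cons] at h3
    exact hne h3.1
  have e := IsFreeGroup.toFreeGroup H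
  have : Subsingleton (IsFreeGroup.Generators H) := ⟨hsub⟩
  have hcyc : IsCyclic (FreeGroup (IsFreeGroup.Generators H)) := by
    by_cases hne : Nonempty (IsFreeGroup.Generators H)
    · obtain ⟨i⟩ := hne
      refine ⟨FreeGroup.of i, fun x => ?_⟩
      change x ∈ Subgroup.zpowers (FreeGroup.of i)
      induction x using FreeGroup.induction_on with
      | C1 => exact one_mem _
      | of j => rw [hsub j i]; exact Subgroup.mem_zpowers _
      | inv_of j _ => rw [hsub j i]; exact inv_mem (Subgroup.mem_zpowers _)
      | mul x y hx hy => exact mul_mem hx hy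
    · have : IsEmpty (IsFreeGroup.Generators H) := not_nonempty_iff.mp hne
      infer_instance
  exact isCyclic_of_surjective e.symm.toMonoidHom e.symm.surjective

variable {α : Type}

theorem commute_of_pow {x y : FreeGroup α} {n : ℤ} (hn : n ≠ 0) (h : Commute (x ^ n) y) :
    Commute x y := by
  have h1 : (y * x * y⁻¹) ^ n = x ^ n := by
    rw [conj_zpow, ← h.eq]; group
  have h2 := zpow_left_injective hn h1
  have : y * x = x * y := by
    have h3 : y * x * y⁻¹ = x := h2
    calc y * x = y * x * y⁻¹ * y := by group
      _ = x * y := by rw [h3]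
  exact this.symm

theorem commute_common {z w : FreeGroup α} (h : Commute z w) :
    ∃ (t : FreeGroup α) (a b : ℤ), z = t ^ a ∧ w = t ^ b := by
  let H := Subgroup.closure ({z, w} : Set (FreeGroup α))
  have hcomm : ∀ a b : H, a * b = b * a := by
    have := Subgroup.closure_le_centralizer_centralizer ({z, w} : Set (FreeGroup α))
    have h2 : IsMulCommutative H := by
      apply Subgroup.isMulCommutative_closure
      intro x hx y hy
      simp only [Set.mem_insert_iff, Set.mem_singleton_iff] at hx hy
      rcases hx with rfl | rfl <;> rcases hy with rfl | rfl <;>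
        first | rfl | exact h.eq | exact h.eq.symm
    intro a b
    exact h2.is_comm.comm a b
  have := isCyclic_of_free_comm H hcomm
  obtain ⟨t, ht⟩ := this.exists_generator
  obtain ⟨a, ha⟩ := Subgroup.mem_zpowers_iff.1 (ht ⟨z, Subgroup.subset_closure (by simp)⟩)
  obtain ⟨b, hb⟩ := Subgroup.mem_zpowers_iff.1 (ht ⟨w, Subgroup.subset_closure (by simp)⟩)
  refine ⟨t, a, b, ?_, ?_⟩
  · have := congrArg Subtype.val ha; simpa using this.symm
  · have := congrArg Subtype.val hb; simpa using this.symm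

theorem commute_trans {z w v : FreeGroup α} (hz : z ≠ 1) (h1 : Commute w z) (h2 : Commute z v) :
    Commute w v := by
  obtain ⟨s, a, b, hs, hw⟩ := commute_common h1.symm
  obtain ⟨t, c, d, ht, hv⟩ := commute_common h2
  have ha : a ≠ 0 := by rintro rfl; simp at hs; exact hz hs
  have hc : c ≠ 0 := by rintro rfl; simp at ht; exact hz ht
  have e1 : w ^ a = z ^ b := by rw [hw, hs, ← zpow_mul, ← zpow_mul, mul_comm]
  have e2 : v ^ c = z ^ d := by rw [hv, ht, ← zpow_mul, ← zpow_mul, mul_comm]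
  apply commute_of_pow ha
  apply Commute.symm
  apply commute_of_pow hc
  rw [e1, e2]
  exact (Commute.refl z).zpow_zpow _ _

/-- roots: nontrivial elements generating their centralizer -/
def IsRootEl (U : FreeGroup α) : Prop := U ≠ 1 ∧ ∀ w, Commute U w → ∃ k : ℤ, w = U ^ k

theorem exists_root {z : FreeGroup α} (hz : z ≠ 1) :
    ∃ (U : FreeGroup α) (a : ℤ), IsRootEl U ∧ z = U ^ a ∧ a ≠ 0 := by
  let H := Subgroup.centralizer ({z} : Set (FreeGroup α))
  have hmem : ∀ w, w ∈ H ↔ Commute z w := by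
    intro w
    rw [Subgroup.mem_centralizer_singleton_iff]
    exact ⟨fun h => h.symm, fun h => h.symm⟩
  have hcomm : ∀ a b : H, a * b = b * a := by
    rintro ⟨a, ha⟩ ⟨b, hb⟩
    rw [hmem] at ha hb
    exact Subtype.ext (commute_trans hz ha.symm hb).eq
  have := isCyclic_of_free_comm H hcomm
  obtain ⟨⟨t, htH⟩, ht⟩ := this.exists_generator
  obtain ⟨a, ha⟩ := Subgroup.mem_zpowers_iff.1 (ht ⟨z, (hmem z).2 (Commute.refl z)⟩)
  have ha' : z = t ^ a := by have := congrArg Subtype.val ha; simpa using this.symm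
  have ha0 : a ≠ 0 := by rintro rfl; simp at ha'; exact hz ha'
  refine ⟨t, a, ⟨?_, ?_⟩, ha', ha0⟩
  · rintro rfl; simp at ha'; exact hz ha'
  · intro w hw
    have hzw : Commute z w := by rw [ha']; exact hw.zpow_left a
    obtain ⟨b, hb⟩ := Subgroup.mem_zpowers_iff.1 (ht ⟨w, (hmem w).2 hzw⟩)
    exact ⟨b, by have := congrArg Subtype.val hb; simpa using this.symm⟩

theorem IsRootEl.conj {U : FreeGroup α} (h : IsRootEl U) (g : FreeGroup α) :
    IsRootEl (g * U * g⁻¹) := by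
  refine ⟨fun hh => h.1 (by simpa using hh), fun w hw => ?_⟩
  obtain ⟨k, hk⟩ := h.2 (g⁻¹ * w * g) (by
    have := hw.eq
    show U * (g⁻¹ * w * g) = (g⁻¹ * w * g) * U
    calc U * (g⁻¹ * w * g) = g⁻¹ * ((g * U * g⁻¹) * w) * g := by group
      _ = _ := by rw [this]; group)
  refine ⟨k, ?_⟩
  rw [conj_zpow, ← hk]; group

theorem isRootEl_of_hom {z : FreeGroup α} (χ : FreeGroup α →* Multiplicative ℤ)
    (h : χ z = Multiplicative.ofAdd 1) : IsRootEl z := by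
  have hz : z ≠ 1 := by
    rintro rfl
    simp at h
    exact absurd (congrArg Multiplicative.toAdd h) (by simp)
  obtain ⟨U, a, hU, hza, ha⟩ := exists_root hz
  refine ⟨hz, fun w hw => ?_⟩
  have h1 : a * Multiplicative.toAdd (χ U) = 1 := by
    rw [hza, map_zpow] at h
    have := congrArg Multiplicative.toAdd h
    simpa using this
  have hUw : Commute U w := by
    apply commute_of_pow ha; rw [← hza]; exact hw
  obtain ⟨k, hk⟩ := hU.2 w hUw
  have ha2 : a * a = 1 := by
    rcases Int.eq_one_or_neg_one_of_mul_eq_one h1 with h | h <;> simp [h]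
  exact ⟨a * k, by rw [hza, ← zpow_mul, ← mul_assoc, ha2, one_mul, hk]⟩

theorem zpow_ne_one_of_ne {z : FreeGroup α} (hz : z ≠ 1) {n : ℤ} (hn : n ≠ 0) : z ^ n ≠ 1 := by
  intro h
  exact hz (zpow_left_injective hn (by simpa using h))

theorem zpow_inj {z : FreeGroup α} (hz : z ≠ 1) {m n : ℤ} (h : z ^ m = z ^ n) : m = n := by
  by_contra hne
  have : z ^ (m - n) = 1 := by rw [zpow_sub, h, mul_inv_cancel]
  exact zpow_ne_one_of_ne hz (sub_ne_zero.2 hne) this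

end FAP
end

section
namespace FAP
section count
variable {β : Type}

/-- number of occurrences of `w` as a subword of `l` -/
def cnt [DecidableEq β] (w l : List β) : ℕ := ((Finset.range l.length).filter (fun i => w <+: l.drop i)).card

theorem cnt_zero_of [DecidableEq β] {w l : List β} (h : ∀ i, ¬ w <+: l.drop i) : cnt w l = 0 := by
  simp [cnt, h]

theorem len_of_occ {w l : List β} {i : ℕ} (h : w <+: l.drop i) (hw : w ≠ []) :
    i + w.length ≤ l.length := by
  have h1 := h.length_le
  have h2 : 0 < w.length := List.length_pos_iff.2 hw
  rw [List.length_drop] at h1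
  omega

theorem cnt_append [DecidableEq β] {w : List β} {n : ℕ} (hn : 0 < n) (hw : w.length = 2 * n)
    (hs : ∀ (l : List β) (i j : ℕ), w <+: l.drop i → w <+: l.drop j → i < j → i + n ≤ j)
    (a b : List β) :
    cnt w a + cnt w b ≤ cnt w (a ++ b) ∧ cnt w (a ++ b) ≤ cnt w a + cnt w b + 2 := by
  have hwne : w ≠ [] := by rintro rfl; simp at hw; omega
  set A := (Finset.range a.length).filter (fun i => w <+: a.drop i) with hA
  set B := ((Finset.range b.length).filter (fun i => w <+: b.drop i)).image (fun i => i + a.length) with hB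
  set C := (Finset.range (a ++ b).length).filter (fun i => w <+: (a ++ b).drop i) with hC
  have hBc : B.card = cnt w b := by
    rw [hB, Finset.card_image_of_injective _ (fun x y h => by simpa using h)]; rfl
  have hdisj : Disjoint A B := by
    rw [Finset.disjoint_left]
    intro i hi hi2
    simp only [hA, hB, Finset.mem_filter, Finset.mem_range, Finset.mem_image] at hi hi2
    obtain ⟨k, -, hk⟩ := hi2
    omega
  have hsub : A ∪ B ⊆ C := by
    intro i hi
    simp only [hA, hB, hC, Finset.mem_union, Finset.mem_filter, Finset.mem_range, Finset.mem_image] at hi ⊢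
    rcases hi with ⟨h1, h2⟩ | ⟨k, ⟨h1, h2⟩, rfl⟩
    · refine ⟨by simp; omega, ?_⟩
      rw [List.drop_append_of_le_length h1.le]
      exact h2.trans (List.prefix_append _ _)
    · refine ⟨by simp; omega, ?_⟩
      rw [add_comm, List.drop_length_add_append]
      exact h2
  have hX : (C \ (A ∪ B)).card ≤ 2 := by
    have hmem : ∀ i ∈ C \ (A ∪ B), w <+: (a ++ b).drop i ∧ i < a.length ∧ a.length < i + 2 * n := by
      intro i hi
      simp only [hA, hB, hC, Finset.mem_union, Finset.mem_sdiff, Finset.mem_filter, Finset.mem_range, Finset.mem_image, not_or] at hi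
      obtain ⟨⟨h1, h2⟩, h3, h4⟩ := hi
      have hia : i < a.length := by
        by_contra hcon
        push Not at hcon
        apply h4
        refine ⟨i - a.length, ⟨?_, ?_⟩, by omega⟩
        · simp at h1; omega
        · obtain ⟨k, rfl⟩ := Nat.exists_eq_add_of_le hcon
          rw [List.drop_length_add_append] at h2
          simpa using h2
      refine ⟨h2, hia, ?_⟩
      by_contra hcon
      push Not at hcon
      apply h3
      refine ⟨hia, ?_⟩
      rw [List.drop_append_of_le_length hia.le] at h2
      apply List.prefix_of_prefix_length_le h2 (List.prefix_append _ _)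
      rw [List.length_drop]; omega
    by_contra hcon
    push Not at hcon
    obtain ⟨x, hx, y, hy, z, hz, hxy, hxz, hyz⟩ := Finset.two_lt_card.1 hcon
    have ox := hmem x hx
    have oy := hmem y hy
    have oz := hmem z hz
    have key : ∀ i j : ℕ, w <+: (a ++ b).drop i → w <+: (a ++ b).drop j → i ≠ j → i + n ≤ j ∨ j + n ≤ i := by
      intro i j h1 h2 hij
      rcases lt_or_gt_of_ne hij with h | h
      · exact Or.inl (hs _ _ _ h1 h2 h)
      · exact Or.inr (hs _ _ _ h2 h1 h)
    have k1 := key x y ox.1 oy.1 hxy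
    have k2 := key x z ox.1 oz.1 hxz
    have k3 := key y z oy.1 oz.1 hyz
    omega
  have hcard : C.card = (A ∪ B).card + (C \ (A ∪ B)).card := by
    have := Finset.card_sdiff_add_card_eq_card hsub
    omega
  have hAB : (A ∪ B).card = A.card + B.card := Finset.card_union_of_disjoint hdisj
  have e1 : cnt w a = A.card := rfl
  have e2 : cnt w (a ++ b) = C.card := rfl
  omega

/-- iterated word -/
abbrev rep (m : ℕ) (v : List β) : List β := (List.replicate m v).flatten

theorem rep_length (m : ℕ) (v : List β) : (rep m v).length = m * v.length := by
  simp [rep]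

theorem rep_succ (m : ℕ) (v : List β) : rep (m + 1) v = v ++ rep m v := by
  simp [rep, List.replicate_succ]

theorem rep_add (m k : ℕ) (v : List β) : rep (m + k) v = rep m v ++ rep k v := by
  rw [rep, rep, rep, ← List.flatten_append, List.replicate_append_replicate]

theorem cnt_rep [DecidableEq β] {u : List β} (hu : u ≠ [])
    (hs : ∀ (l : List β) (i j : ℕ), (u ++ u) <+: l.drop i → (u ++ u) <+: l.drop j → i < j →
      i + u.length ≤ j) (m : ℕ) :
    m ≤ cnt (u ++ u) (rep m u) + 1 ∧ cnt (u ++ u) (rep m u) ≤ m := by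
  have hn : 0 < u.length := List.length_pos_iff.2 hu
  constructor
  · rcases m with _ | m
    · simp
    have : (Finset.range m).card ≤ cnt (u ++ u) (rep (m + 1) u) := by
      apply Finset.card_le_card_of_injOn (fun j => j * u.length)
      · intro j hj
        simp only [Finset.coe_range, Set.mem_Iio] at hj
        simp only [Finset.coe_filter, Finset.mem_range, Set.mem_ofPred_eq, rep_length]
        refine ⟨Nat.mul_lt_mul_of_pos_right (by omega) hn, ?_⟩
        obtain ⟨k, rfl⟩ : ∃ k, m = j + (k + 1) := ⟨m - j - 1, by omega⟩
        have : rep (j + (k + 1) + 1) u = rep j u ++ rep (k + 2) u := by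
          rw [← rep_add]; rfl
        rw [this, ← rep_length j u, List.drop_left, rep_succ, rep_succ, ← List.append_assoc]
        exact List.prefix_append _ _
      · intro i _ j _ h
        exact Nat.eq_of_mul_eq_mul_right hn h
    simp at this
    omega
  · have : cnt (u ++ u) (rep m u) ≤ (Finset.range m).card := by
      apply Finset.card_le_card_of_injOn (fun j => j / u.length)
      · intro j hj
        simp only [Finset.coe_filter, Finset.mem_range, Set.mem_ofPred_eq, rep_length] at hj
        simp only [Finset.coe_range, Set.mem_Iio]
        exact Nat.div_lt_of_lt_mul (by rw [mul_comm]; exact hj.1)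
      · intro i hi j hj h
        simp only [Finset.coe_filter, Finset.mem_range, Set.mem_ofPred_eq] at hi hj
        by_contra hne
        have h' : i / u.length = j / u.length := h
        have m1 := Nat.div_add_mod i u.length
        have m2 := Nat.div_add_mod j u.length
        have l1 := Nat.mod_lt i hn
        have l2 := Nat.mod_lt j hn
        rw [h'] at m1
        rcases lt_or_gt_of_ne hne with h | h
        · have := hs _ _ _ hi.2 hj.2 h; omega
        · have := hs _ _ _ hj.2 hi.2 h; omega
    simpa using this

/-- overlap of a square with itself -/
theorem overlap {u l : List β} {i d : ℕ} (h1 : (u ++ u) <+: l.drop i) (h2 : (u ++ u) <+: l.drop (i + d))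
    (hd : d < u.length) : u.take d ++ u = u ++ u.take d := by
  rw [← List.drop_drop] at h2
  obtain ⟨r, hr⟩ := h1
  rw [← hr] at h2
  have h3 : u <+: (u ++ (u ++ r)).drop d := by
    rw [← List.append_assoc]; exact (List.prefix_append _ _).trans h2
  rw [List.drop_append_of_le_length hd.le] at h3
  have h4 : u.take d ++ u <+: u ++ (u ++ r) := by
    have : u ++ (u ++ r) = u.take d ++ (u.drop d ++ (u ++ r)) := by
      rw [← List.append_assoc (u.take d), List.take_append_drop]
    rw [this]
    exact (List.prefix_append_right_inj _).2 h3
  have h5 : u ++ u.take d <+: u ++ (u ++ r) := by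
    rw [List.prefix_append_right_inj]
    exact (List.take_prefix _ _).trans (List.prefix_append _ _)
  exact List.IsPrefix.eq_of_length (List.prefix_of_prefix_length_le h4 h5 (by simp; omega)) (by simp; omega)

theorem rotate_rep (r : ℕ) (v : List β) (M : ℕ) :
    v.take r ++ rep M (v.drop r ++ v.take r) = rep M v ++ v.take r := by
  induction M with
  | zero => simp [rep]
  | succ M ih =>
    rw [rep_succ, rep_succ, List.append_assoc, List.append_assoc, ih, ← List.append_assoc, List.take_append_drop]

theorem square_in_rep {u v : List β} (hu : u ≠ []) (hlen : v.length ≤ u.length) {N i : ℕ}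
    (h : (u ++ u) <+: (rep N v).drop i) :
    ∃ r, let z := v.drop r ++ v.take r
      z ++ u = u ++ z ∧ z <+: u := by
  have hul : 0 < u.length := List.length_pos_iff.2 hu
  have hle := len_of_occ h (by simp [hu])
  rw [rep_length] at hle
  have hv : 0 < v.length := by
    rcases Nat.eq_zero_or_pos v.length with h0 | h0
    · rw [h0, List.length_append] at hle; omega
    · exact h0
  set q := i / v.length
  set r := i % v.length
  have hi : i = q * v.length + r := by
    have := Nat.div_add_mod i v.length; rw [mul_comm]; exact this.symm
  have hr : r < v.length := Nat.mod_lt _ hv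
  have hqN : q < N := by
    by_contra hcon
    push Not at hcon
    have : N * v.length ≤ q * v.length := Nat.mul_le_mul_right _ hcon
    simp at hle
    omega
  refine ⟨r, ?_⟩
  intro z
  obtain ⟨M, rfl⟩ : ∃ M, N = q + (M + 1) := ⟨N - q - 1, by omega⟩
  have hzl : z.length = v.length := by simp [z]; omega
  have h1 : (u ++ u) <+: rep (M + 1) z := by
    rw [rep_add, hi, ← rep_length q v, List.drop_length_add_append] at h
    refine h.trans ?_
    have := rotate_rep r v (M + 1)
    have h2 : rep (M + 1) z = (rep (M + 1) v ++ v.take r).drop r := by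
      rw [← this, List.drop_append_of_le_length (by simp; omega)]
      simp [z]
    rw [h2, List.drop_append_of_le_length (by rw [rep_length]; nlinarith)]
    exact List.prefix_append _ _
  have hz : z <+: u := by
    apply List.prefix_of_prefix_length_le (l₃ := rep (M + 1) z)
    · rw [rep_succ]; exact List.prefix_append _ _
    · exact (List.prefix_append _ _).trans h1
    · omega
  refine ⟨?_, hz⟩
  obtain ⟨y, hy⟩ := hz
  have h3 : u <+: y ++ u := by
    have h4 : y ++ u <+: rep M z := by
      rw [rep_succ] at h1
      nth_rewrite 1 [← hy] at h1
      rw [List.append_assoc, List.prefix_append_right_inj] at h1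
      exact h1
    have h5 : rep M z <+: rep (M + 1) z := by
      rw [rep_add M 1]; exact List.prefix_append _ _
    apply List.prefix_of_prefix_length_le ((List.prefix_append _ _).trans h1) (h4.trans h5)
    simp
  have h6 : z ++ u <+: u ++ u := by
    have : u ++ u = z ++ (y ++ u) := by rw [← List.append_assoc, hy]
    rw [this]
    exact (List.prefix_append_right_inj _).2 h3
  have h7 : u ++ z <+: u ++ u := by
    rw [List.prefix_append_right_inj]; exact ⟨y, hy⟩
  exact List.IsPrefix.eq_of_length (List.prefix_of_prefix_length_le h6 h7 (by simp; omega)) (by simp; omega)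

end count
end FAP
end

section
namespace FAP
section qm
variable {α : Type} [DecidableEq α]

theorem split_words (l : List (α × Bool)) : ∀ m : List (α × Bool),
    FreeGroup.IsReduced l → FreeGroup.IsReduced m →
    ∃ a r b, l = a ++ r ∧ m = FreeGroup.invRev r ++ b ∧ FreeGroup.IsReduced (a ++ b) := by
  induction l using List.reverseRecOn with
  | nil =>
    intro m _ hm
    exact ⟨[], [], m, rfl, by simp, hm⟩
  | append_singleton l x ih =>
    intro m hl hm
    by_cases h : FreeGroup.IsReduced ((l ++ [x]) ++ m)
    · exact ⟨l ++ [x], [], m, by simp, by simp, h⟩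
    · rcases m with _ | ⟨y, m⟩
      · simp at h; exact absurd hl h
      · have hxy : x.1 = y.1 ∧ x.2 ≠ y.2 := by
          by_contra hcon
          apply h
          unfold FreeGroup.IsReduced at *
          rw [List.isChain_append]
          refine ⟨hl, hm, ?_⟩
          intro a ha b hb
          simp at ha hb
          subst ha; subst hb
          intro h1
          by_contra h2
          exact hcon ⟨h1, h2⟩
        have hl' : FreeGroup.IsReduced l := by
          unfold FreeGroup.IsReduced at *
          exact (List.isChain_append.1 hl).1
        have hm' : FreeGroup.IsReduced m := by
          unfold FreeGroup.IsReduced at *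
          exact List.IsChain.tail hm
        obtain ⟨a, r, b, e1, e2, e3⟩ := ih m hl' hm'
        refine ⟨a, r ++ [x], b, by rw [e1]; simp, ?_, e3⟩
        have : y = (x.1, !x.2) := by
          ext
          · exact hxy.1.symm
          · have := hxy.2
            cases hx : x.2 <;> cases hy : y.2 <;> simp_all
        rw [e2, this]
        simp [FreeGroup.invRev]

theorem split_mul (g h : FreeGroup α) : ∃ a r b, g.toWord = a ++ r ∧
    h.toWord = FreeGroup.invRev r ++ b ∧ (g * h).toWord = a ++ b := by
  obtain ⟨a, r, b, e1, e2, e3⟩ := split_words g.toWord h.toWord FreeGroup.isReduced_toWord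
    FreeGroup.isReduced_toWord
  refine ⟨a, r, b, e1, e2, ?_⟩
  have hgh : g * h = FreeGroup.mk (a ++ b) := by
    rw [← FreeGroup.mk_toWord (x := g), ← FreeGroup.mk_toWord (x := h), e1, e2,
      ← FreeGroup.mul_mk, ← FreeGroup.mul_mk, ← FreeGroup.mul_mk, ← FreeGroup.inv_mk]
    group
  rw [hgh, FreeGroup.toWord_mk]
  exact e3.reduce_eq

/-- cyclically reduced elements -/
def CycRed (U : FreeGroup α) : Prop := FreeGroup.IsCyclicallyReduced U.toWord

theorem CycRed.toWord_pow {U : FreeGroup α} (h : CycRed U) (n : ℕ) :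
    (U ^ n).toWord = rep n U.toWord := by
  rw [FreeGroup.toWord_pow]
  exact (FreeGroup.IsCyclicallyReduced.flatten_replicate h n).isReduced.reduce_eq

theorem CycRed.inv {U : FreeGroup α} (h : CycRed U) : CycRed U⁻¹ := by
  have h2 := h.toWord_pow 2
  have h3 : (U⁻¹ ^ 2).toWord = rep 2 U⁻¹.toWord := by
    rw [inv_pow, FreeGroup.toWord_inv, h2, FreeGroup.toWord_inv]
    simp [rep, List.replicate_succ]
  have h4 : FreeGroup.IsReduced (rep 2 U⁻¹.toWord) := by
    rw [← h3]; exact FreeGroup.isReduced_toWord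
  simp only [rep, List.replicate_succ, List.replicate_zero, List.flatten_cons, List.flatten_nil,
    List.append_nil] at h4
  unfold CycRed
  rw [FreeGroup.isCyclicallyReduced_iff]
  unfold FreeGroup.IsReduced at *
  rw [List.isChain_append] at h4
  exact ⟨h4.1, h4.2.2⟩

theorem CycRed.norm_zpow {U : FreeGroup α} (h : CycRed U) (k : ℤ) :
    (U ^ k).norm = k.natAbs * U.norm := by
  have key : ∀ n : ℕ, (U ^ n).norm = n * U.norm := by
    intro n
    unfold FreeGroup.norm
    rw [h.toWord_pow, rep_length]
  obtain ⟨n, rfl | rfl⟩ := Int.eq_nat_or_neg k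
  · rw [zpow_natCast, key]; simp
  · rw [zpow_neg, FreeGroup.norm_inv_eq, zpow_natCast, key]; simp

theorem exists_cycRed (g : FreeGroup α) : ∃ k U : FreeGroup α, CycRed U ∧ g = k * U * k⁻¹ := by
  refine ⟨FreeGroup.mk (FreeGroup.reduceCyclically.conjugator g.toWord),
    FreeGroup.mk (FreeGroup.reduceCyclically g.toWord), ?_, ?_⟩
  · have := FreeGroup.reduceCyclically.isCyclicallyReduced (FreeGroup.isReduced_toWord (x := g))
    unfold CycRed
    rw [FreeGroup.toWord_mk, this.isReduced.reduce_eq]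
    exact this
  · have := FreeGroup.reduceCyclically.conj_conjugator_reduceCyclically g.toWord
    conv_lhs => rw [← FreeGroup.mk_toWord (x := g), ← this]
    simp [← FreeGroup.mul_mk, FreeGroup.inv_mk, mul_assoc]

theorem spaced {U : FreeGroup α} (h : CycRed U) (hr : IsRootEl U)
    (l : List (α × Bool)) (i j : ℕ) (h1 : (U.toWord ++ U.toWord) <+: l.drop i)
    (h2 : (U.toWord ++ U.toWord) <+: l.drop j) (hij : i < j) : i + U.toWord.length ≤ j := by
  by_contra hcon
  push Not at hcon
  obtain ⟨d, rfl⟩ := Nat.exists_eq_add_of_lt hij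
  have hd : d + 1 < U.toWord.length := by omega
  have := overlap h1 (by rw [← add_assoc]; exact h2) hd
  have hcomm : Commute U (FreeGroup.mk (U.toWord.take (d + 1))) := by
    have e := congrArg FreeGroup.mk this
    rw [← FreeGroup.mul_mk, ← FreeGroup.mul_mk, FreeGroup.mk_toWord] at e
    exact e.symm
  obtain ⟨k, hk⟩ := hr.2 _ hcomm
  have hred : FreeGroup.IsReduced (U.toWord.take (d + 1)) := by
    have := FreeGroup.isReduced_toWord (x := U)
    unfold FreeGroup.IsReduced at *
    exact List.IsChain.take this _
  have hn := h.norm_zpow k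
  rw [← hk] at hn
  unfold FreeGroup.norm at hn
  rw [FreeGroup.toWord_mk, hred.reduce_eq, List.length_take, min_eq_left hd.le] at hn
  rcases Nat.eq_zero_or_pos k.natAbs with h0 | h0
  · rw [h0] at hn; omega
  · nlinarith

/-- counting quasimorphism -/
def qm (U g : FreeGroup α) : ℤ :=
  (cnt (U.toWord ++ U.toWord) g.toWord : ℤ) - cnt (U.toWord ++ U.toWord) g⁻¹.toWord

theorem qm_inv (U g : FreeGroup α) : qm U g⁻¹ = - qm U g := by
  simp [qm]

theorem qm_mul {U : FreeGroup α} (h : CycRed U) (hr : IsRootEl U) (g k : FreeGroup α) :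
    |qm U (g * k) - qm U g - qm U k| ≤ 6 := by
  have hn : 0 < U.toWord.length := by
    rw [List.length_pos_iff]; intro h0; exact hr.1 (FreeGroup.toWord_eq_nil_iff.1 h0)
  have ap := cnt_append hn (by simp; omega) (spaced h hr)
  obtain ⟨a, r, b, e1, e2, e3⟩ := split_mul g k
  unfold qm
  rw [FreeGroup.toWord_inv, FreeGroup.toWord_inv, FreeGroup.toWord_inv, e1, e2, e3]
  rw [FreeGroup.invRev_append, FreeGroup.invRev_append, FreeGroup.invRev_append,
    FreeGroup.invRev_invRev]
  have a1 := ap a r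
  have a2 := ap (FreeGroup.invRev r) b
  have a3 := ap a b
  have a4 := ap (FreeGroup.invRev b) (FreeGroup.invRev a)
  have a5 := ap (FreeGroup.invRev r) (FreeGroup.invRev a)
  have a6 := ap (FreeGroup.invRev b) r
  rw [abs_le]
  constructor <;> omega

theorem qm_conj {U : FreeGroup α} (h : CycRed U) (hr : IsRootEl U) (g k : FreeGroup α) :
    |qm U (g * k * g⁻¹) - qm U k| ≤ 12 := by
  have h1 := qm_mul h hr (g * k) g⁻¹
  have h2 := qm_mul h hr g k
  rw [qm_inv] at h1
  rw [abs_le] at *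
  constructor <;> linarith [h1.1, h1.2, h2.1, h2.2]

theorem not_conj_inv {U : FreeGroup α} (hr : IsRootEl U) (g : FreeGroup α) :
    U ≠ g * U⁻¹ * g⁻¹ := by
  intro h
  have h1 : U⁻¹ = g * U * g⁻¹ := by
    conv_lhs => rw [h]
    group
  have h2 : Commute (g ^ (2 : ℤ)) U := by
    show g ^ (2 : ℤ) * U = U * g ^ (2 : ℤ)
    have : U = g * (g * U * g⁻¹) * g⁻¹ := by rw [← h1]; exact h
    conv_rhs => rw [this]
    rw [zpow_two]
    group
  have h3 := commute_of_pow (by norm_num) h2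
  have h4 : U⁻¹ = U := by
    rw [h1, h3.eq]; group
  have h5 : U ^ (2 : ℤ) = 1 := by
    rw [zpow_two]; nth_rewrite 1 [← h4]; group
  exact zpow_ne_one_of_ne hr.1 (by norm_num) h5

theorem occ_conj {U V : FreeGroup α} (hr : IsRootEl U) (hV : CycRed V)
    (hle : V.norm ≤ U.norm) (N : ℕ) (hne : cnt (U.toWord ++ U.toWord) (V ^ N).toWord ≠ 0) :
    ∃ g, Commute U (g * V * g⁻¹) ∧ (V.norm = U.norm → U = g * V * g⁻¹) := by
  have : ∃ i, (U.toWord ++ U.toWord) <+: (rep N V.toWord).drop i := by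
    by_contra hcon
    push Not at hcon
    rw [hV.toWord_pow] at hne
    exact hne (cnt_zero_of hcon)
  obtain ⟨i, hi⟩ := this
  have hU : U.toWord ≠ [] := fun h0 => hr.1 (FreeGroup.toWord_eq_nil_iff.1 h0)
  obtain ⟨r, h1, h2⟩ := square_in_rep hU hle hi
  refine ⟨(FreeGroup.mk (V.toWord.take r))⁻¹, ?_⟩
  have hz : FreeGroup.mk (V.toWord.drop r ++ V.toWord.take r) =
      (FreeGroup.mk (V.toWord.take r))⁻¹ * V * (FreeGroup.mk (V.toWord.take r))⁻¹⁻¹ := by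
    have : V = FreeGroup.mk (V.toWord.take r) * FreeGroup.mk (V.toWord.drop r) := by
      rw [FreeGroup.mul_mk, List.take_append_drop, FreeGroup.mk_toWord]
    rw [← FreeGroup.mul_mk]
    nth_rewrite 4 [this]
    group
  rw [← hz]
  refine ⟨?_, ?_⟩
  · have e := congrArg FreeGroup.mk h1
    rw [← FreeGroup.mul_mk, ← FreeGroup.mul_mk (L₁ := U.toWord), FreeGroup.mk_toWord] at e
    exact e.symm
  · intro hlen
    have := h2.eq_of_length (by
      unfold FreeGroup.norm at hlen
      rw [← hlen, List.length_append, add_comm, ← List.length_append, List.take_append_drop])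
    rw [this, FreeGroup.mk_toWord]

theorem qm_npow_self {U : FreeGroup α} (h : CycRed U) (hr : IsRootEl U) (m : ℕ) :
    |qm U (U ^ m) - m| ≤ 1 := by
  have hU : U.toWord ≠ [] := fun h0 => hr.1 (FreeGroup.toWord_eq_nil_iff.1 h0)
  have h1 := cnt_rep hU (spaced h hr) m
  rw [← h.toWord_pow] at h1
  have h2 : cnt (U.toWord ++ U.toWord) (U⁻¹ ^ m).toWord = 0 := by
    by_contra hne
    obtain ⟨g, -, hg⟩ := occ_conj hr h.inv (by rw [FreeGroup.norm_inv_eq]) m hne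
    exact not_conj_inv hr g (hg FreeGroup.norm_inv_eq)
  unfold qm
  rw [← inv_pow, h2, abs_le]
  constructor <;> push_cast <;> omega

theorem qm_zpow_self {U : FreeGroup α} (h : CycRed U) (hr : IsRootEl U) (m : ℤ) :
    |qm U (U ^ m) - m| ≤ 1 := by
  rcases Int.natAbs_eq m with hk | hk
  · rw [hk, zpow_natCast]; exact qm_npow_self h hr _
  · rw [hk, zpow_neg, qm_inv, zpow_natCast]
    have := qm_npow_self h hr m.natAbs
    rw [abs_le] at *
    constructor <;> linarith [this.1, this.2]

theorem qm_zpow_other {U V : FreeGroup α} (hr : IsRootEl U) (hV : CycRed V)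
    (hle : V.norm ≤ U.norm) (hno : ∀ g, ¬ Commute U (g * V * g⁻¹)) (m : ℤ) :
    qm U (V ^ m) = 0 := by
  have key : ∀ (W : FreeGroup α), CycRed W → W.norm ≤ U.norm →
      (∀ g, ¬ Commute U (g * W * g⁻¹)) → ∀ N : ℕ,
      cnt (U.toWord ++ U.toWord) (W ^ N).toWord = 0 := by
    intro W hW hl hn N
    by_contra hne
    obtain ⟨g, hg, -⟩ := occ_conj hr hW hl N hne
    exact hn g hg
  have k1 := key V hV hle hno
  have k2 := key V⁻¹ hV.inv (by rwa [FreeGroup.norm_inv_eq]) (by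
    intro g hg
    apply hno g
    have := hg.inv_right
    have e : (g * V⁻¹ * g⁻¹)⁻¹ = g * V * g⁻¹ := by group
    rwa [e] at this)
  have k3 : ∀ N : ℕ, qm U (V ^ N) = 0 := by
    intro N
    unfold qm
    rw [← inv_pow, k1, k2]; simp
  rcases Int.natAbs_eq m with hk | hk
  · rw [hk, zpow_natCast]; exact k3 _
  · rw [hk, zpow_neg, qm_inv, zpow_natCast, k3, neg_zero]

end qm
end FAP
end

section
namespace FAP

/-- `x` commutes with a conjugate of `y` -/
def ConjComm {G : Type} [Group G] (x y : G) : Prop :=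
  ∃ k : G, x * (k * y * k⁻¹) = (k * y * k⁻¹) * x

def Psi {G : Type} [Group G] (K R : ℕ) (e e' : ℤ) (z z' : G) : Prop :=
  ∃ k u : G, z * u = u * z ∧ (k * z' * k⁻¹) * u = u * (k * z' * k⁻¹) ∧
    z * (k * z' * k⁻¹) = (k * z' * k⁻¹) * z ∧
    (∃ j : ℤ, |j| ≤ K ∧ z ^ e * (k * z' * k⁻¹) ^ (-e') = u ^ j) ∧
    ∀ n : ℕ, 2 ≤ n → n ≤ R → ∀ s : G, s ^ n ≠ u

/-- the main sentence -/
def Sig (G : Type) [Group G] (K R : ℕ) (p p' : ℤ) : Prop :=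
  ∀ x y h l x' y' h' : G,
    x ^ p * y ^ (1 - p) * (h * l⁻¹ * h⁻¹) = x' ^ p' * y' ^ (1 - p') * (h' * l⁻¹ * h'⁻¹) →
    ConjComm x y ∨ ConjComm x' y' ∨ Psi K R p p' x x' ∨ Psi K R p (1 - p') x y' ∨
      Psi K R (1 - p) p' y x' ∨ Psi K R (1 - p) (1 - p') y y'

variable {α : Type}

theorem ConjComm.symm {G : Type} [Group G] {x y : G} (h : ConjComm x y) : ConjComm y x := by
  obtain ⟨k, hk⟩ := h
  refine ⟨k⁻¹, ?_⟩
  calc y * (k⁻¹ * x * k⁻¹⁻¹) = k⁻¹ * ((k * y * k⁻¹) * x) * k := by group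
    _ = _ := by rw [← hk]; group

theorem IsRootEl.not_pow {u : FreeGroup α} (h : IsRootEl u) {n : ℕ} (hn : 2 ≤ n) (s : FreeGroup α) :
    s ^ n ≠ u := by
  intro hs
  have hc : Commute u s := by rw [← hs]; exact (Commute.refl s).pow_left n
  obtain ⟨k, hk⟩ := h.2 s hc
  rw [hk] at hs
  have : u ^ (k * n) = u ^ (1 : ℤ) := by rw [zpow_mul, zpow_natCast, hs, zpow_one]
  have h2 := zpow_inj h.1 this
  rcases Int.eq_one_or_neg_one_of_mul_eq_one h2 with h | h <;> rw [h] at h2 <;> omega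

theorem exists_cyc_root [DecidableEq α] {z : FreeGroup α} (hz : z ≠ 1) :
    ∃ (g U : FreeGroup α) (a : ℤ), CycRed U ∧ IsRootEl U ∧ z = g * U ^ a * g⁻¹ ∧ a ≠ 0 := by
  obtain ⟨V, a, hV, hza, ha⟩ := exists_root hz
  obtain ⟨g, U, hU, hg⟩ := exists_cycRed V
  refine ⟨g, U, a, hU, ?_, ?_, ha⟩
  · have := hV.conj g⁻¹
    have e : g⁻¹ * V * g⁻¹⁻¹ = U := by rw [hg]; group
    rwa [e] at this
  · rw [hza, hg, conj_zpow]

theorem four [DecidableEq α] (z : Fin 4 → FreeGroup α) (hz : ∀ i, z i ≠ 1) (E : Fin 4 → ℤ)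
    (hE : ∀ i, 100 < |E i|)
    (hq : ∀ U : FreeGroup α, CycRed U → IsRootEl U → |∑ i, qm U (z i ^ E i)| ≤ 48) :
    (∃ i j k, i ≠ j ∧ i ≠ k ∧ j ≠ k ∧ ConjComm (z i) (z j) ∧ ConjComm (z i) (z k) ∧
      ConjComm (z j) (z k)) ∨
    (∃ i j, i ≠ j ∧ ConjComm (z i) (z j) ∧ ∃ (v k₁ k₂ : FreeGroup α) (a b : ℤ), IsRootEl v ∧
      k₁ * z i * k₁⁻¹ = v ^ a ∧ k₂ * z j * k₂⁻¹ = v ^ b ∧ |E i * a + E j * b| ≤ 100) := by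
  choose g U a hU hr hzU ha using fun i => exists_cyc_root (hz i)
  obtain ⟨i, -, hi⟩ := Finset.exists_max_image (Finset.univ : Finset (Fin 4)) (fun i => (U i).norm)
    ⟨0, Finset.mem_univ _⟩
  have hi' : ∀ j, (U j).norm ≤ (U i).norm := fun j => hi j (Finset.mem_univ j)
  let c : Fin 4 → Prop := fun j => ∃ k b, k * z j * k⁻¹ = (U i) ^ (b : ℤ)
  have hci : (g i)⁻¹ * z i * (g i)⁻¹⁻¹ = (U i) ^ (a i) := by rw [hzU i]; group
  have hcc : ∀ j j', c j → c j' → ConjComm (z j) (z j') := by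
    rintro j j' ⟨k, b, h1⟩ ⟨k', b', h2⟩
    have e1 : z j = k⁻¹ * (U i) ^ b * k := by rw [← h1]; group
    refine ⟨k⁻¹ * k', ?_⟩
    have e2 : k⁻¹ * k' * z j' * (k⁻¹ * k')⁻¹ = k⁻¹ * (U i) ^ b' * k := by rw [← h2]; group
    rw [e2, e1]
    calc k⁻¹ * (U i) ^ b * k * (k⁻¹ * (U i) ^ b' * k) = k⁻¹ * ((U i) ^ b * (U i) ^ b') * k := by group
      _ = k⁻¹ * ((U i) ^ b' * (U i) ^ b) * k := by rw [← zpow_add, ← zpow_add, add_comm]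
      _ = _ := by group
  have hnear : ∀ j k (b : ℤ), k * z j * k⁻¹ = (U i) ^ b → |qm (U i) (z j ^ E j) - E j * b| ≤ 13 := by
    intro j k b h
    have e1 : z j ^ E j = k⁻¹ * (U i) ^ (E j * b) * k⁻¹⁻¹ := by
      have : z j = k⁻¹ * (U i) ^ b * k⁻¹⁻¹ := by rw [← h]; group
      rw [this, conj_zpow, ← zpow_mul, mul_comm b]
    have h1 := qm_conj (hU i) (hr i) k⁻¹ ((U i) ^ (E j * b))
    have h2 := qm_zpow_self (hU i) (hr i) (E j * b)
    rw [← e1] at h1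
    rw [abs_le] at *
    constructor <;> linarith [h1.1, h1.2, h2.1, h2.2]
  have hfar : ∀ j, ¬ c j → |qm (U i) (z j ^ E j)| ≤ 13 := by
    intro j hj
    have h0 := qm_zpow_other (hr i) (hU j) (hi' j) (by
      intro k hk
      obtain ⟨m, hm⟩ := (hr i).2 _ hk
      apply hj
      refine ⟨k * (g j)⁻¹, m * a j, ?_⟩
      rw [hzU j, zpow_mul, ← hm, conj_zpow]; group) (a j * E j)
    have e1 : z j ^ E j = g j * (U j) ^ (a j * E j) * (g j)⁻¹ := by
      rw [zpow_mul, ← conj_zpow, ← hzU j]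
    have h1 := qm_conj (hU i) (hr i) (g j) ((U j) ^ (a j * E j))
    rw [← e1, h0, sub_zero] at h1
    linarith
  have hsum := hq (U i) (hU i) (hr i)
  have hclose : ∀ t : Fin 4 → ℤ, (∀ k, |qm (U i) (z k ^ E k) - t k| ≤ 13) → |∑ k, t k| ≤ 100 := by
    intro t ht
    have h0 := ht 0
    have h1 := ht 1
    have h2 := ht 2
    have h3 := ht 3
    rw [Fin.sum_univ_four] at *
    rw [abs_le] at *
    constructor <;> linarith [h0.1, h0.2, h1.1, h1.2, h2.1, h2.2, h3.1, h3.2]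
  have hcI : c i := ⟨_, _, hci⟩
  by_cases h1 : ∃ j, j ≠ i ∧ c j
  · obtain ⟨j, hji, hcj⟩ := h1
    by_cases h2 : ∃ k, k ≠ i ∧ k ≠ j ∧ c k
    · left
      obtain ⟨k, hki, hkj, hck⟩ := h2
      exact ⟨i, j, k, hji.symm, hki.symm, hkj.symm, hcc _ _ hcI hcj, hcc _ _ hcI hck, hcc _ _ hcj hck⟩
    · right
      obtain ⟨k, b, hkb⟩ := id hcj
      refine ⟨i, j, hji.symm, hcc _ _ hcI hcj, U i, (g i)⁻¹, k, a i, b, hr i, hci, hkb, ?_⟩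
      have := hclose (Pi.single i (E i * a i) + Pi.single j (E j * b)) (by
        intro m
        by_cases hmi : m = i
        · subst hmi
          simp only [Pi.add_apply, Pi.single_eq_same, Pi.single_eq_of_ne hji.symm, add_zero]
          exact hnear _ _ _ hci
        by_cases hmj : m = j
        · subst hmj
          simp only [Pi.add_apply, Pi.single_eq_same, Pi.single_eq_of_ne hji, zero_add]
          exact hnear _ _ _ hkb
        · simp only [Pi.add_apply, Pi.single_eq_of_ne hmi, Pi.single_eq_of_ne hmj, add_zero, sub_zero]
          exact hfar m (fun hc => h2 ⟨m, hmi, hmj, hc⟩))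
      simpa [Finset.sum_add_distrib] using this
  · exfalso
    have := hclose (Pi.single i (E i * a i)) (by
      intro m
      by_cases hmi : m = i
      · subst hmi
        simp only [Pi.single_eq_same]
        exact hnear _ _ _ hci
      · simp only [Pi.single_eq_of_ne hmi, sub_zero]
        exact hfar m (fun hc => h1 ⟨m, hmi, hc⟩))
    simp only [Finset.sum_pi_single', Finset.mem_univ, if_true] at this
    rw [abs_mul] at this
    have h3 : 1 ≤ |a i| := Int.one_le_abs (ha i)
    nlinarith [hE i]

theorem psi_of {K R : ℕ} {e e' : ℤ} {z z' v k₁ k₂ : FreeGroup α} {a b : ℤ} (hv : IsRootEl v)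
    (h1 : k₁ * z * k₁⁻¹ = v ^ a) (h2 : k₂ * z' * k₂⁻¹ = v ^ b) (h3 : |e * a + -e' * b| ≤ K) :
    Psi K R e e' z z' := by
  have e1 : z = k₁⁻¹ * v ^ a * k₁⁻¹⁻¹ := by rw [← h1]; group
  have e2 : (k₁⁻¹ * k₂) * z' * (k₁⁻¹ * k₂)⁻¹ = k₁⁻¹ * v ^ b * k₁⁻¹⁻¹ := by rw [← h2]; group
  refine ⟨k₁⁻¹ * k₂, k₁⁻¹ * v * k₁⁻¹⁻¹, ?_, ?_, ?_, ⟨e * a + -e' * b, h3, ?_⟩, ?_⟩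
  · rw [e1, ← conj_zpow]
    exact (Commute.refl _).zpow_left a
  · rw [e2, ← conj_zpow]
    exact (Commute.refl _).zpow_left b
  · rw [e2, e1, ← conj_zpow, ← conj_zpow]
    exact (Commute.refl _).zpow_zpow a b
  · rw [e2, e1, ← conj_zpow, ← conj_zpow, ← zpow_mul, ← zpow_mul, ← zpow_add]
    congr 1; ring
  · intro n hn _ s
    exact (hv.conj k₁⁻¹).not_pow hn s

theorem sig_free [DecidableEq α] (p p' : ℤ) (R : ℕ) (h1 : 100 < |p|) (h2 : 100 < |1 - p|) (h3 : 100 < |p'|)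
    (h4 : 100 < |1 - p'|) : Sig (FreeGroup α) 100 R p p' := by
  intro x y h l x' y' h' heq
  by_cases hx : x = 1
  · left; exact ⟨1, by simp [hx]⟩
  by_cases hy : y = 1
  · left; exact ⟨1, by simp [hy]⟩
  by_cases hx' : x' = 1
  · right; left; exact ⟨1, by simp [hx']⟩
  by_cases hy' : y' = 1
  · right; left; exact ⟨1, by simp [hy']⟩
  have := four ![x, y, x', y'] (by intro i; fin_cases i <;> simpa) ![p, 1 - p, -p', -(1 - p')]
    (by intro i; fin_cases i <;> simp [h1, h3, abs_sub_comm] <;> rw [abs_sub_comm] <;> assumption) (by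
    intro U hU hr
    have a1 := qm_mul hU hr (x ^ p * y ^ (1 - p)) (h * l⁻¹ * h⁻¹)
    have a2 := qm_mul hU hr (x ^ p) (y ^ (1 - p))
    have a3 := qm_conj hU hr h l⁻¹
    have a4 := qm_mul hU hr (x' ^ p' * y' ^ (1 - p')) (h' * l⁻¹ * h'⁻¹)
    have a5 := qm_mul hU hr (x' ^ p') (y' ^ (1 - p'))
    have a6 := qm_conj hU hr h' l⁻¹
    rw [heq] at a1
    rw [Fin.sum_univ_four]
    change |qm U (x ^ p) + qm U (y ^ (1 - p)) + qm U (x' ^ (-p')) + qm U (y' ^ (-(1 - p')))| ≤ 48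
    rw [zpow_neg, qm_inv, zpow_neg, qm_inv]
    rw [abs_le] at *
    constructor <;> linarith [a1.1, a1.2, a2.1, a2.2, a3.1, a3.2, a4.1, a4.2, a5.1, a5.2, a6.1, a6.2])
  rcases this with ⟨i, j, k, hij, hik, hjk, c1, c2, c3⟩ | ⟨i, j, hij, hc, v, k₁, k₂, a, b, hv, e1, e2, e3⟩
  · have key : ∀ r : Fin 4 → Fin 4 → Prop, (∀ i j, r i j → r j i) → r i j → r i k → r j k → r 0 1 ∨ r 2 3 := by
      intro r hs r1 r2 r3
      have s1 := hs _ _ r1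
      have s2 := hs _ _ r2
      have s3 := hs _ _ r3
      clear c1 c2 c3
      fin_cases i <;> fin_cases j <;> fin_cases k <;> simp_all
    rcases key (fun i j => ConjComm (![x, y, x', y'] i) (![x, y, x', y'] j))
      (fun i j h => h.symm) c1 c2 c3 with h | h
    · left; exact h
    · right; left; exact h
  · have key : ∀ r : Fin 4 → Fin 4 → Prop, (∀ i j, r i j → r j i) → r i j →
        r 0 1 ∨ r 2 3 ∨ r 0 2 ∨ r 0 3 ∨ r 1 2 ∨ r 1 3 := by
      intro r hs r1
      have s1 := hs _ _ r1
      clear hc e1 e2 e3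
      fin_cases i <;> fin_cases j <;> simp_all
    let z : Fin 4 → FreeGroup α := ![x, y, x', y']
    let E : Fin 4 → ℤ := ![p, 1 - p, -p', -(1 - p')]
    rcases key (fun i j => ConjComm (z i) (z j) ∧ ∃ (v k₁ k₂ : FreeGroup α) (a b : ℤ), IsRootEl v ∧
      k₁ * z i * k₁⁻¹ = v ^ a ∧ k₂ * z j * k₂⁻¹ = v ^ b ∧ |E i * a + E j * b| ≤ 100)
      (fun i j h => by
        obtain ⟨h, v, k₁, k₂, a, b, hv, e1, e2, e3⟩ := h
        exact ⟨h.symm, v, k₂, k₁, b, a, hv, e2, e1, by rw [add_comm]; exact e3⟩)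
      ⟨hc, v, k₁, k₂, a, b, hv, e1, e2, e3⟩ with h | h | h | h | h | h
    · exact Or.inl h.1
    · exact Or.inr (Or.inl h.1)
    · obtain ⟨-, v, k₁, k₂, a, b, hv, e1, e2, e3⟩ := h
      exact Or.inr (Or.inr (Or.inl (psi_of hv e1 e2 e3)))
    · obtain ⟨-, v, k₁, k₂, a, b, hv, e1, e2, e3⟩ := h
      exact Or.inr (Or.inr (Or.inr (Or.inl (psi_of hv e1 e2 e3))))
    · obtain ⟨-, v, k₁, k₂, a, b, hv, e1, e2, e3⟩ := h
      exact Or.inr (Or.inr (Or.inr (Or.inr (Or.inl (psi_of hv e1 e2 e3)))))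
    · obtain ⟨-, v, k₁, k₂, a, b, hv, e1, e2, e3⟩ := h
      exact Or.inr (Or.inr (Or.inr (Or.inr (Or.inr (psi_of hv e1 e2 e3)))))

end FAP
end

section
namespace FAP
open scoped Pointwise MatrixGroups

section sanov

def sA : SL(2, ℤ) := ⟨!![1, 2; 0, 1], by simp [Matrix.det_fin_two]⟩
def sB : SL(2, ℤ) := ⟨!![1, 0; 2, 1], by simp [Matrix.det_fin_two]⟩

theorem sA_coe : (sA : Matrix (Fin 2) (Fin 2) ℤ) = !![1, 2; 0, 1] := rfl
theorem sB_coe : (sB : Matrix (Fin 2) (Fin 2) ℤ) = !![1, 0; 2, 1] := rfl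

def inX0 (x y : ℤ) : Prop := y = 0 ∨ (y > 0 ∧ x ≥ y) ∨ (y < 0 ∧ x ≤ y)
def inY0 (x y : ℤ) : Prop := (y > 0 ∧ x < -y) ∨ (y < 0 ∧ x > -y)
def inX1 (x y : ℤ) : Prop := (y > 0 ∧ 0 ≤ x ∧ x < y) ∨ (y < 0 ∧ x ≤ 0 ∧ x > y)
def inY1 (x y : ℤ) : Prop := (y > 0 ∧ -y ≤ x ∧ x < 0) ∨ (y < 0 ∧ 0 < x ∧ x ≤ -y)

theorem sanov_injective : Function.Injective (FreeGroup.lift (![sA, sB] : Fin 2 → SL(2, ℤ))) := by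
  let X : Fin 2 → Set SL(2, ℤ) := ![{M | inX0 (M 0 0) (M 1 0)}, {M | inX1 (M 0 0) (M 1 0)}]
  let Y : Fin 2 → Set SL(2, ℤ) := ![{M | inY0 (M 0 0) (M 1 0)}, {M | inY1 (M 0 0) (M 1 0)}]
  have hX0 : ∀ M, M ∈ X 0 ↔ inX0 (M 0 0) (M 1 0) := fun M => Iff.rfl
  have hX1 : ∀ M, M ∈ X 1 ↔ inX1 (M 0 0) (M 1 0) := fun M => Iff.rfl
  have hY0 : ∀ M, M ∈ Y 0 ↔ inY0 (M 0 0) (M 1 0) := fun M => Iff.rfl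
  have hY1 : ∀ M, M ∈ Y 1 ↔ inY1 (M 0 0) (M 1 0) := fun M => Iff.rfl
  have hnz : ∀ M : SL(2, ℤ), ¬ (M 0 0 = 0 ∧ M 1 0 = 0) := by
    rintro M ⟨h1, h2⟩
    have := M.det_coe
    rw [Matrix.det_fin_two] at this
    rw [h1, h2] at this
    simp at this
  apply FreeGroup.injective_lift_of_ping_pong _ X Y
  · intro i
    fin_cases i
    · refine ⟨1, ?_⟩
      change inX0 _ _
      simp [inX0]
    · refine ⟨⟨!![0, -1; 1, 0], by simp [Matrix.det_fin_two]⟩, ?_⟩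
      change inX1 _ _
      simp [inX1]
  · intro i j hij
    fin_cases i <;> fin_cases j <;> first | exact absurd rfl hij | skip
    all_goals
      refine Set.disjoint_left.2 fun M h1 h2 => ?_
      simp [hX0, hX1, inX0, inX1] at h1 h2
      omega
  · intro i j hij
    fin_cases i <;> fin_cases j <;> first | exact absurd rfl hij | skip
    all_goals
      refine Set.disjoint_left.2 fun M h1 h2 => ?_
      simp [hY0, hY1, inY0, inY1] at h1 h2
      omega
  · intro i j
    fin_cases i <;> fin_cases j
    all_goals
      refine Set.disjoint_left.2 fun M h1 h2 => ?_
      simp [hX0, hX1, hY0, hY1, inX0, inX1, inY0, inY1] at h1 h2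
      omega
  · intro i
    fin_cases i
    · rintro _ ⟨M, hM, rfl⟩
      have h0 := hnz M
      change ¬ inY0 (M 0 0) (M 1 0) at hM
      change inX0 ((sA * M) 0 0) ((sA * M) 1 0)
      have e1 : (sA * M) 0 0 = M 0 0 + 2 * M 1 0 := by
        rw [Matrix.SpecialLinearGroup.coe_mul, sA_coe]; simp [Matrix.mul_apply, Fin.sum_univ_two]
      have e2 : (sA * M) 1 0 = M 1 0 := by
        rw [Matrix.SpecialLinearGroup.coe_mul, sA_coe]; simp [Matrix.mul_apply, Fin.sum_univ_two]
      rw [e1, e2]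
      simp only [inX0, inY0] at *
      omega
    · rintro _ ⟨M, hM, rfl⟩
      have h0 := hnz M
      change ¬ inY1 (M 0 0) (M 1 0) at hM
      change inX1 ((sB * M) 0 0) ((sB * M) 1 0)
      have e1 : (sB * M) 0 0 = M 0 0 := by
        rw [Matrix.SpecialLinearGroup.coe_mul, sB_coe]; simp [Matrix.mul_apply, Fin.sum_univ_two]
      have e2 : (sB * M) 1 0 = 2 * M 0 0 + M 1 0 := by
        rw [Matrix.SpecialLinearGroup.coe_mul, sB_coe]; simp [Matrix.mul_apply, Fin.sum_univ_two]
      rw [e1, e2]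
      simp only [inX1, inY1] at *
      omega
  · intro i
    fin_cases i
    · rintro _ ⟨M, hM, rfl⟩
      have h0 := hnz M
      change ¬ inX0 (M 0 0) (M 1 0) at hM
      change inY0 ((sA⁻¹ * M) 0 0) ((sA⁻¹ * M) 1 0)
      have e1 : (sA⁻¹ * M) 0 0 = M 0 0 - 2 * M 1 0 := by
        rw [Matrix.SpecialLinearGroup.coe_mul, Matrix.SpecialLinearGroup.coe_inv, sA_coe]; simp [Matrix.mul_apply, Fin.sum_univ_two, Matrix.adjugate_fin_two]
        ring
      have e2 : (sA⁻¹ * M) 1 0 = M 1 0 := by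
        rw [Matrix.SpecialLinearGroup.coe_mul, Matrix.SpecialLinearGroup.coe_inv, sA_coe]; simp [Matrix.mul_apply, Fin.sum_univ_two, Matrix.adjugate_fin_two]
      rw [e1, e2]
      simp only [inX0, inY0] at *
      omega
    · rintro _ ⟨M, hM, rfl⟩
      have h0 := hnz M
      change ¬ inX1 (M 0 0) (M 1 0) at hM
      change inY1 ((sB⁻¹ * M) 0 0) ((sB⁻¹ * M) 1 0)
      have e1 : (sB⁻¹ * M) 0 0 = M 0 0 := by
        rw [Matrix.SpecialLinearGroup.coe_mul, Matrix.SpecialLinearGroup.coe_inv, sB_coe]; simp [Matrix.mul_apply, Fin.sum_univ_two, Matrix.adjugate_fin_two]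
      have e2 : (sB⁻¹ * M) 1 0 = M 1 0 - 2 * M 0 0 := by
        rw [Matrix.SpecialLinearGroup.coe_mul, Matrix.SpecialLinearGroup.coe_inv, sB_coe]; simp [Matrix.mul_apply, Fin.sum_univ_two, Matrix.adjugate_fin_two]
        ring
      rw [e1, e2]
      simp only [inX1, inY1] at *
      omega

/-- the faithful representation used -/
def rho : FreeGroup (Fin 2) →* SL(2, ℤ) := FreeGroup.lift ![sA * sB, sA * (sA * sB)]

theorem rho_injective : Function.Injective rho := by
  let φ : FreeGroup (Fin 2) →* FreeGroup (Fin 2) := FreeGroup.lift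
    ![FreeGroup.of 0 * FreeGroup.of 1, FreeGroup.of 0 * (FreeGroup.of 0 * FreeGroup.of 1)]
  let ψ : FreeGroup (Fin 2) →* FreeGroup (Fin 2) := FreeGroup.lift
    ![FreeGroup.of 1 * (FreeGroup.of 0)⁻¹,
      (FreeGroup.of 1 * (FreeGroup.of 0)⁻¹)⁻¹ * FreeGroup.of 0]
  have h1 : rho = (FreeGroup.lift ![sA, sB]).comp φ := by
    ext1 i
    fin_cases i <;> simp [rho, φ]
  have h2 : ψ.comp φ = MonoidHom.id _ := by
    ext1 i
    fin_cases i <;> simp [φ, ψ] <;> group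
  rw [h1, MonoidHom.coe_comp]
  refine sanov_injective.comp ?_
  have : Function.LeftInverse ψ φ := fun x => DFunLike.congr_fun h2 x
  exact this.injective

end sanov
end FAP
end

section
namespace FAP
open scoped Pointwise MatrixGroups Topology
open Filter

/-- real matrix of an integer matrix -/
noncomputable def rm (A : SL(2, ℤ)) : Matrix (Fin 2) (Fin 2) ℝ :=
  (A : Matrix (Fin 2) (Fin 2) ℤ).map (Int.cast : ℤ → ℝ)

theorem rm_mul (A B : SL(2, ℤ)) : rm (A * B) = rm A * rm B := by
  unfold rm
  rw [Matrix.SpecialLinearGroup.coe_mul]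
  exact Matrix.map_mul (f := Int.castRingHom ℝ)

theorem rm_one : rm 1 = 1 := by
  unfold rm
  rw [Matrix.SpecialLinearGroup.coe_one]
  exact Matrix.map_one (Int.cast : ℤ → ℝ) (by simp) (by simp)

def tr (A : SL(2, ℤ)) : ℤ := (A 0 0 + A 1 1)

theorem det_eq (A : SL(2, ℤ)) : A 0 0 * A 1 1 - A 0 1 * A 1 0 = 1 := by
  have := A.det_coe
  rwa [Matrix.det_fin_two] at this

theorem sq_ne (t X Y : ℤ) (ht : 3 ≤ t) (hY : Y ≠ 0) : X ^ 2 ≠ (t ^ 2 - 4) * Y ^ 2 := by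
  intro h
  have hd : Y ^ 2 ∣ X ^ 2 := ⟨t ^ 2 - 4, by rw [h]; ring⟩
  rw [Int.pow_dvd_pow_iff (by norm_num)] at hd
  obtain ⟨Z, rfl⟩ := hd
  have h2 : Z ^ 2 = t ^ 2 - 4 := by
    have hY2 : Y ^ 2 ≠ 0 := pow_ne_zero _ hY
    apply mul_left_cancel₀ hY2
    linarith [h, mul_pow Y Z 2]
  have h3 : |Z| ^ 2 = t ^ 2 - 4 := by rw [sq_abs]; exact h2
  have h4 := abs_nonneg Z
  have h5 : |Z| < t := by nlinarith
  have h6 : t - 1 < |Z| := by nlinarith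
  omega

theorem commute_of_eigen (P Q : SL(2, ℤ)) (hP : 3 ≤ tr P) (v : Fin 2 → ℝ) (hv : v ≠ 0)
    (l k : ℝ) (h1 : (rm P).mulVec v = l • v) (h2 : (rm Q).mulVec v = k • v) : Commute P Q := by
  by_contra hc
  have hPQ : ((P * Q : SL(2, ℤ)) : Matrix (Fin 2) (Fin 2) ℤ) ≠ (Q * P : SL(2, ℤ)) := by
    intro h; exact hc (Subtype.ext h)
  have hD : (rm (P * Q)).mulVec v = (rm (Q * P)).mulVec v := by
    rw [rm_mul, rm_mul, ← Matrix.mulVec_mulVec, ← Matrix.mulVec_mulVec, h1, h2,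
      Matrix.mulVec_smul, Matrix.mulVec_smul, h1, h2, smul_smul, smul_smul, mul_comm]
  obtain ⟨i, j, hij⟩ : ∃ i j, (P * Q) i j ≠ (Q * P) i j := by
    by_contra hcon
    push Not at hcon
    exact hPQ (Matrix.ext hcon)
  set a : ℤ := (P * Q) i 0 - (Q * P) i 0 with ha
  set b : ℤ := (P * Q) i 1 - (Q * P) i 1 with hb
  have hab : ¬ (a = 0 ∧ b = 0) := by
    rintro ⟨h0, h1⟩
    fin_cases j
    · exact hij (by simpa [ha, sub_eq_zero] using h0)
    · exact hij (by simpa [hb, sub_eq_zero] using h1)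
  have hrow : (a : ℝ) * v 0 + b * v 1 = 0 := by
    have := congrFun hD i
    simp [rm, Matrix.mulVec, dotProduct, Fin.sum_univ_two] at this
    rw [ha, hb]
    push_cast
    simp only [Matrix.SpecialLinearGroup.coe_mul]
    linarith
  have e0 : (P 0 0 : ℝ) * v 0 + P 0 1 * v 1 = l * v 0 := by
    have := congrFun h1 0
    simpa [rm, Matrix.mulVec, dotProduct, Fin.sum_univ_two] using this
  have e1 : (P 1 0 : ℝ) * v 0 + P 1 1 * v 1 = l * v 1 := by
    have := congrFun h1 1
    simpa [rm, Matrix.mulVec, dotProduct, Fin.sum_univ_two] using this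
  have hv' : ¬ (v 0 = 0 ∧ v 1 = 0) := by
    rintro ⟨h0, h1⟩
    apply hv; ext m; fin_cases m <;> simpa
  have hdet := det_eq P
  have hdetR : (P 0 0 : ℝ) * P 1 1 - P 0 1 * P 1 0 = 1 := by exact_mod_cast hdet
  -- v is proportional to (b, -a)
  obtain ⟨s, hs, hs0, hs1⟩ : ∃ s : ℝ, s ≠ 0 ∧ v 0 = s * b ∧ v 1 = - (s * a) := by
    by_cases hb0 : b = 0
    · have ha0 : a ≠ 0 := fun h => hab ⟨h, hb0⟩
      have ha0' : (a : ℝ) ≠ 0 := by exact_mod_cast ha0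
      have hv0 : v 0 = 0 := by
        rw [hb0] at hrow; simp at hrow
        exact hrow.resolve_left ha0
      have hv1 : v 1 ≠ 0 := fun h => hv' ⟨hv0, h⟩
      refine ⟨-(v 1 / a), ?_, ?_, ?_⟩
      · exact neg_ne_zero.2 (div_ne_zero hv1 ha0')
      · rw [hb0, hv0]; simp
      · field_simp
    · have hb0' : (b : ℝ) ≠ 0 := by exact_mod_cast hb0
      have hv0 : v 0 ≠ 0 := by
        intro h
        rw [h] at hrow; simp at hrow
        exact hv' ⟨h, hrow.resolve_left hb0⟩
      refine ⟨v 0 / b, div_ne_zero hv0 hb0', by field_simp, ?_⟩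
      field_simp
      linarith
  rw [hs0, hs1] at e0 e1
  have f0 : (P 0 0 : ℝ) * b - P 0 1 * a = l * b := by
    apply mul_left_cancel₀ hs; linarith
  have f1 : (P 1 0 : ℝ) * b - P 1 1 * a = - (l * a) := by
    apply mul_left_cancel₀ hs; linarith
  -- characteristic equation
  have hchar : l ^ 2 - (tr P : ℝ) * l + 1 = 0 := by
    unfold tr
    push_cast
    by_cases hb0 : b = 0
    · have ha0 : (a : ℝ) ≠ 0 := by
        have : a ≠ 0 := fun h => hab ⟨h, hb0⟩
        exact_mod_cast this
      rw [hb0] at f0 f1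
      simp at f0 f1
      have g0 : (P 0 1 : ℝ) = 0 := by
        rcases f0 with h | h
        · exact_mod_cast h
        · exact absurd (by exact_mod_cast h) ha0
      have g1 : l = P 1 1 := by
        rcases f1 with h | h
        · exact h.symm
        · exact absurd (by exact_mod_cast h) ha0
      rw [g0] at hdetR
      rw [g1]
      linarith
    · have hb0' : (b : ℝ) ≠ 0 := by exact_mod_cast hb0
      have : (b : ℝ) * (l ^ 2 - ((P 0 0 : ℝ) + P 1 1) * l + 1) = 0 := by
        have g : l * (l * b) = l * (P 0 0 * b - P 0 1 * a) := by rw [f0]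
        have g2 : (P 0 1 : ℝ) * (P 1 0 * b - P 1 1 * a) = P 0 1 * (-(l * a)) := by rw [f1]
        have g3 : (P 1 1 : ℝ) * (P 0 0 * b - P 0 1 * a) = P 1 1 * (l * b) := by rw [f0]
        have g4 : (b : ℝ) * (P 0 0 * P 1 1 - P 0 1 * P 1 0) = b * 1 := by rw [hdetR]
        linarith
      exact (mul_eq_zero.1 this).resolve_left hb0'
  have hsq : (2 * l - tr P) ^ 2 = (tr P : ℝ) ^ 2 - 4 := by linarith
  by_cases hb0 : b = 0
  · have ha0 : a ≠ 0 := fun h => hab ⟨h, hb0⟩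
    apply sq_ne (tr P) (2 * (P 1 1 * a - P 1 0 * b) - tr P * a) a hP ha0
    have : ((2 * (P 1 1 * a - P 1 0 * b) - tr P * a : ℤ) : ℝ) = (2 * l - tr P) * a := by
      push_cast; linarith
    have h7 : ((2 * (P 1 1 * a - P 1 0 * b) - tr P * a : ℤ) : ℝ) ^ 2 = ((tr P : ℝ) ^ 2 - 4) * a ^ 2 := by
      rw [this, mul_pow, hsq]
    exact_mod_cast h7
  · apply sq_ne (tr P) (2 * (P 0 0 * b - P 0 1 * a) - tr P * b) b hP hb0
    have : ((2 * (P 0 0 * b - P 0 1 * a) - tr P * b : ℤ) : ℝ) = (2 * l - tr P) * b := by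
      push_cast; linarith
    have h7 : ((2 * (P 0 0 * b - P 0 1 * a) - tr P * b : ℤ) : ℝ) ^ 2 = ((tr P : ℝ) ^ 2 - 4) * b ^ 2 := by
      rw [this, mul_pow, hsq]
    exact_mod_cast h7

/-- asymptotics of powers of a hyperbolic matrix -/
theorem pow_asymp (A : SL(2, ℤ)) (hA : 3 ≤ tr A) : ∃ (l : ℝ) (E : Matrix (Fin 2) (Fin 2) ℝ),
    1 < l ∧ Tendsto (fun n : ℕ => (l ^ n)⁻¹ • rm (A ^ n)) atTop (𝓝 E) ∧
    rm A * E = l • E ∧ E ≠ 0 ∧ ∀ v, E.mulVec v = 0 → (rm A).mulVec v = l⁻¹ • v := by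
  set t : ℝ := (tr A : ℝ) with ht
  have ht3 : 3 ≤ t := by rw [ht]; exact_mod_cast hA
  set r := Real.sqrt (t ^ 2 - 4) with hr
  have hr2 : r ^ 2 = t ^ 2 - 4 := Real.sq_sqrt (by nlinarith)
  have hr0 : 0 < r := Real.sqrt_pos.2 (by nlinarith)
  set l := (t + r) / 2 with hl
  have hl1 : 1 < l := by rw [hl]; linarith
  have hl0 : l ≠ 0 := by linarith
  have hlinv : l⁻¹ = t - l := by
    exact inv_eq_of_mul_eq_one_right (by rw [hl]; nlinarith)
  have hdiff : l - l⁻¹ = r := by rw [hlinv, hl]; ring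
  have hlm : l * l⁻¹ = 1 := mul_inv_cancel₀ hl0
  have hCH : rm A * rm A = t • rm A - 1 := by
    have hdet := det_eq A
    have hdetR : (A 0 0 : ℝ) * A 1 1 - A 0 1 * A 1 0 = 1 := by exact_mod_cast hdet
    rw [ht]
    unfold tr
    ext i j
    fin_cases i <;> fin_cases j <;>
      simp [rm, Matrix.mul_apply, Fin.sum_univ_two] <;> linarith
  set N := rm A - l⁻¹ • (1 : Matrix (Fin 2) (Fin 2) ℝ) with hN
  set M := l • (1 : Matrix (Fin 2) (Fin 2) ℝ) - rm A with hM
  have hAN : rm A * N = l • N := by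
    rw [hN, mul_sub, hCH, Matrix.mul_smul, mul_one, smul_sub, smul_smul, hlm, one_smul]
    rw [show t = l + l⁻¹ by rw [hlinv]; ring, add_smul]
    abel
  have hAM : rm A * M = l⁻¹ • M := by
    rw [hM, mul_sub, hCH, Matrix.mul_smul, mul_one, smul_sub, smul_smul, mul_comm, hlm, one_smul]
    rw [show t = l + l⁻¹ by rw [hlinv]; ring, add_smul]
    abel
  have hpow : ∀ n : ℕ, r • rm (A ^ n) = l ^ n • N + (l⁻¹) ^ n • M := by
    intro n
    induction n with
    | zero =>
      rw [pow_zero, rm_one, ← hdiff]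
      simp only [pow_zero, one_smul, hN, hM, sub_smul]
      abel
    | succ n ih =>
      rw [pow_succ', rm_mul, ← Matrix.mul_smul, ih, mul_add, Matrix.mul_smul, Matrix.mul_smul,
        hAN, hAM, smul_smul, smul_smul, ← pow_succ, ← pow_succ]
  refine ⟨l, r⁻¹ • N, hl1, ?_, ?_, ?_, ?_⟩
  · have h1 : ∀ n : ℕ, (l ^ n)⁻¹ • rm (A ^ n) = r⁻¹ • (N + ((l⁻¹ * l⁻¹) ^ n) • M) := by
      intro n
      have : rm (A ^ n) = r⁻¹ • (l ^ n • N + (l⁻¹) ^ n • M) := by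
        rw [← hpow, smul_smul, inv_mul_cancel₀ hr0.ne', one_smul]
      rw [this, smul_comm, smul_add, smul_smul, smul_smul, inv_mul_cancel₀ (pow_ne_zero _ hl0), one_smul,
        ← inv_pow, ← mul_pow]
    simp_rw [h1]
    have h2 : Tendsto (fun n : ℕ => (l⁻¹ * l⁻¹) ^ n) atTop (𝓝 0) := by
      apply tendsto_pow_atTop_nhds_zero_of_lt_one
      · positivity
      · have : l⁻¹ < 1 := inv_lt_one_of_one_lt₀ hl1
        have h0 : 0 < l⁻¹ := by positivity
        nlinarith
    have h3 : Tendsto (fun n : ℕ => r⁻¹ • (N + ((l⁻¹ * l⁻¹) ^ n) • M)) atTop (𝓝 (r⁻¹ • (N + (0 : ℝ) • M))) :=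
      (tendsto_const_nhds.add (h2.smul_const M)).const_smul _
    simpa using h3
  · rw [Matrix.mul_smul, hAN, smul_comm]
  · intro h0
    have hN0 : N = 0 := by
      rw [smul_eq_zero] at h0
      exact h0.resolve_left (inv_ne_zero hr0.ne')
    have hAl : rm A = l⁻¹ • 1 := by rw [← sub_eq_zero]; exact hN0
    have htr : t = l⁻¹ + l⁻¹ := by
      have h00 := congrFun (congrFun hAl 0) 0
      have h11 := congrFun (congrFun hAl 1) 1
      simp [rm] at h00 h11
      rw [ht]; unfold tr; push_cast; linarith
    have : l⁻¹ < 1 := inv_lt_one_of_one_lt₀ hl1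
    linarith
  · intro v hv
    rw [Matrix.smul_mulVec, smul_eq_zero] at hv
    have := hv.resolve_left (inv_ne_zero hr0.ne')
    rw [hN, Matrix.sub_mulVec, Matrix.smul_mulVec, Matrix.one_mulVec, sub_eq_zero] at this
    exact this

/-- the product `g₁ A₁ⁿ g₂ A₂ⁿ …` -/
def bp (n : ℕ) : List (SL(2, ℤ) × SL(2, ℤ)) → SL(2, ℤ)
  | [] => 1
  | (g, A) :: L => g * A ^ n * bp n L

def nonComm (a b : SL(2, ℤ) × SL(2, ℤ)) : Prop := ¬ Commute a.2 (b.1 * b.2 * b.1⁻¹)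

theorem rm_inv_mul (g : SL(2, ℤ)) : rm g⁻¹ * rm g = 1 := by
  rw [← rm_mul, inv_mul_cancel, rm_one]

theorem bp_asymp (L : List (SL(2, ℤ) × SL(2, ℤ))) : ∀ (g A : SL(2, ℤ)),
    (∀ x ∈ (g, A) :: L, 3 ≤ tr x.2) → List.IsChain nonComm ((g, A) :: L) →
    ∃ (m : ℝ) (N : Matrix (Fin 2) (Fin 2) ℝ), 1 < m ∧
      Tendsto (fun n : ℕ => (m ^ n)⁻¹ • rm (bp n ((g, A) :: L))) atTop (𝓝 N) ∧
      ∃ (w : Fin 2 → ℝ) (l : ℝ), N.mulVec w ≠ 0 ∧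
        (rm (g * A * g⁻¹)).mulVec (N.mulVec w) = l • N.mulVec w := by
  have eig : ∀ (g A : SL(2, ℤ)) (l : ℝ) (E : Matrix (Fin 2) (Fin 2) ℝ), rm A * E = l • E →
      ∀ w, (rm (g * A * g⁻¹)).mulVec ((rm g * E).mulVec w) = l • (rm g * E).mulVec w := by
    intro g A l E h w
    rw [Matrix.mulVec_mulVec, rm_mul, rm_mul]
    have : rm g * rm A * rm g⁻¹ * (rm g * E) = l • (rm g * E) := by
      calc rm g * rm A * rm g⁻¹ * (rm g * E) = rm g * rm A * (rm g⁻¹ * rm g) * E := by noncomm_ring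
        _ = rm g * (rm A * E) := by rw [rm_inv_mul]; noncomm_ring
        _ = _ := by rw [h, Matrix.mul_smul]
    rw [this, Matrix.smul_mulVec]
  have inj : ∀ (g : SL(2, ℤ)) v, (rm g).mulVec v = 0 → v = 0 := by
    intro g v h
    have : (rm g⁻¹ * rm g).mulVec v = 0 := by rw [← Matrix.mulVec_mulVec, h, Matrix.mulVec_zero]
    rwa [rm_inv_mul, Matrix.one_mulVec] at this
  induction L with
  | nil =>
    intro g A hA _
    obtain ⟨l, E, hl, hT, hAE, hE, -⟩ := pow_asymp A (hA (g, A) (by simp))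
    have hw : ∃ w, E.mulVec w ≠ 0 := by
      by_contra hcon
      push Not at hcon
      apply hE
      exact Matrix.ext_of_mulVec_single fun i => by rw [hcon, Matrix.zero_mulVec]
    obtain ⟨w, hw⟩ := hw
    refine ⟨l, rm g * E, hl, ?_, w, l, ?_, eig g A l E hAE w⟩
    · have : ∀ n : ℕ, (l ^ n)⁻¹ • rm (bp n [(g, A)]) = rm g * ((l ^ n)⁻¹ • rm (A ^ n)) := by
        intro n
        simp only [bp, mul_one]
        rw [rm_mul, Matrix.mul_smul]
      simp_rw [this]
      exact hT.const_mul _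
    · intro h
      rw [← Matrix.mulVec_mulVec] at h
      exact hw (inj g _ h)
  | cons b L ih =>
    intro g A hA hch
    obtain ⟨g', A'⟩ := b
    have hch' := List.isChain_cons_cons.1 hch
    obtain ⟨m, N, hm, hN, w, k, hw, hk⟩ := ih g' A' (fun x hx => hA x (List.mem_cons_of_mem _ hx)) hch'.2
    obtain ⟨l, E, hl, hT, hAE, hE, hker⟩ := pow_asymp A (hA (g, A) (by simp))
    refine ⟨l * m, rm g * (E * N), by nlinarith, ?_, w, l, ?_, ?_⟩
    · have : ∀ n : ℕ, ((l * m) ^ n)⁻¹ • rm (bp n ((g, A) :: (g', A') :: L)) =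
          rm g * (((l ^ n)⁻¹ • rm (A ^ n)) * ((m ^ n)⁻¹ • rm (bp n ((g', A') :: L)))) := by
        intro n
        conv_lhs => rw [bp]
        rw [rm_mul, rm_mul, Matrix.mul_smul, Matrix.smul_mul, Matrix.mul_smul, Matrix.mul_smul, smul_smul,
          mul_pow, mul_inv, mul_assoc, mul_comm (l ^ n)⁻¹]
      simp_rw [this]
      exact (hT.mul hN).const_mul _
    · intro h
      rw [← Matrix.mulVec_mulVec, ← Matrix.mulVec_mulVec] at h
      have h2 := hker _ (inj g _ h)
      exact hch'.1 (commute_of_eigen A (g' * A' * g'⁻¹) (hA (g, A) (by simp)) _ hw _ _ h2 hk)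
    · rw [← Matrix.mul_assoc, ← Matrix.mulVec_mulVec]
      exact eig g A l E hAE _

theorem bp_ne (L : List (SL(2, ℤ) × SL(2, ℤ))) (hL : L ≠ []) (h1 : ∀ x ∈ L, 3 ≤ tr x.2)
    (h2 : List.IsChain nonComm L) (h : SL(2, ℤ)) : ∀ᶠ n in atTop, bp n L ≠ h := by
  rcases L with _ | ⟨⟨g, A⟩, L⟩
  · exact absurd rfl hL
  obtain ⟨m, N, hm, hN, w, l, hw, -⟩ := bp_asymp L g A h1 h2
  have hN0 : N ≠ 0 := by
    rintro rfl; simp at hw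
  have hz : Tendsto (fun n : ℕ => (m ^ n)⁻¹ • rm h) atTop (𝓝 0) := by
    have : Tendsto (fun n : ℕ => (m ^ n)⁻¹) atTop (𝓝 0) := by
      simp_rw [← inv_pow]
      exact tendsto_pow_atTop_nhds_zero_of_lt_one (by positivity) (inv_lt_one_of_one_lt₀ hm)
    simpa using this.smul_const (rm h)
  have hd := hN.sub hz
  rw [sub_zero] at hd
  have hev := hd.eventually_ne hN0
  filter_upwards [hev] with n hn heq
  rw [heq, sub_self] at hn
  exact hn rfl

end FAP
end

section
open scoped Pointwise MatrixGroups
open Filter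
namespace FAP

abbrev F2 := FreeGroup (Fin 2)
abbrev F4 := FreeGroup (Fin 4)
def gc : F2 := FreeGroup.of 0
def gl : F2 := FreeGroup.of 1
def gd : F2 := gc * gl
def gu (p : ℕ) : F2 := gd ^ (-(p : ℤ)) * gc
def gx : F4 := FreeGroup.of 0
def gy : F4 := FreeGroup.of 1
def gh : F4 := FreeGroup.of 2
def gll : F4 := FreeGroup.of 3
def fC (p : ℕ) : F4 := gx ^ (p : ℤ) * gy ^ (1 - (p : ℤ)) * (gh * gll⁻¹ * gh⁻¹)

def alph (p : ℕ) : Fin 3 → (F2 →* F4)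
  | 0 => FreeGroup.lift ![fC p, gll]
  | 1 => FreeGroup.lift ![fC p, (fC p)⁻¹ * gx]
  | 2 => FreeGroup.lift ![gy * (gh * gll⁻¹ * gh⁻¹), gh * gll * gh⁻¹]

def eps (p : ℕ) : Fin 3 → F2
  | 0 => gc
  | 1 => gu p
  | 2 => gl

def tau : Fin 3 → F4
  | 0 => 1
  | 1 => 1
  | 2 => gh

def bet (p n : ℕ) : Fin 3 → F2
  | 0 => 1
  | 1 => gc ^ n
  | 2 => gc ^ n * gu p ^ n

def hn (p n : ℕ) : F4 →* F2 :=
  FreeGroup.lift ![gc ^ n * gd * (gc ^ n)⁻¹, gc ^ n * gu p ^ n * gd * (gc ^ n * gu p ^ n)⁻¹,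
    gc ^ n * gu p ^ n * gl ^ n, gl]

theorem hn_x (p n) : hn p n gx = gc ^ n * gd * (gc ^ n)⁻¹ := by simp [hn, gx]
theorem hn_y (p n) : hn p n gy = gc ^ n * gu p ^ n * gd * (gc ^ n * gu p ^ n)⁻¹ := by
  simp [hn, gy]
theorem hn_h (p n) : hn p n gh = gc ^ n * gu p ^ n * gl ^ n := by simp [hn, gh]
theorem hn_l (p n) : hn p n gll = gl := by simp [hn, gll]

theorem gu_eq (p : ℕ) : gu p = gd ^ (1 - (p : ℤ)) * gl⁻¹ := by
  unfold gu
  rw [show (1 - (p : ℤ)) = -p + 1 by ring, zpow_add, zpow_one]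
  unfold gd; group

theorem hn_hlh (p n : ℕ) : hn p n (gh * gll⁻¹ * gh⁻¹) =
    (gc ^ n * gu p ^ n) * gl⁻¹ * (gc ^ n * gu p ^ n)⁻¹ := by
  simp only [map_mul, map_inv, hn_h, hn_l]
  have : gl ^ n * gl⁻¹ * (gl ^ n)⁻¹ = gl⁻¹ := by group
  calc _ = (gc ^ n * gu p ^ n) * (gl ^ n * gl⁻¹ * (gl ^ n)⁻¹) * (gc ^ n * gu p ^ n)⁻¹ := by group
    _ = _ := by rw [this]

theorem hn_fC (p n : ℕ) : hn p n (fC p) = gc := by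
  unfold fC
  rw [map_mul, hn_hlh, map_mul, map_zpow, map_zpow, hn_x, hn_y, conj_zpow, conj_zpow]
  set b := gc ^ n with hb
  set e := gu p ^ n with he
  have h1 : e * (gd ^ (1 - (p : ℤ)) * gl⁻¹) * e⁻¹ = gu p := by
    rw [← gu_eq, he]; group
  calc _ = b * (gd ^ (p : ℤ) * (e * (gd ^ (1 - (p : ℤ)) * gl⁻¹) * e⁻¹)) * b⁻¹ := by group
    _ = b * gc * b⁻¹ := by rw [h1, gu]; group
    _ = _ := by rw [hb]; group

theorem hom2_ext {G : Type*} [Group G] {f g : F2 →* G} (h0 : f gc = g gc) (h1 : f gl = g gl) :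
    f = g := by
  ext i; fin_cases i
  · exact h0
  · exact h1

theorem alph0_c (p) : alph p 0 gc = fC p := by simp [alph, gc]
theorem alph0_l (p) : alph p 0 gl = gll := by simp [alph, gl]
theorem alph1_c (p) : alph p 1 gc = fC p := by simp [alph, gc]
theorem alph1_l (p) : alph p 1 gl = (fC p)⁻¹ * gx := by simp [alph, gl]
theorem alph2_c (p) : alph p 2 gc = gy * (gh * gll⁻¹ * gh⁻¹) := by simp [alph, gc]
theorem alph2_l (p) : alph p 2 gl = gh * gll * gh⁻¹ := by simp [alph, gl]
theorem alph1_d (p) : alph p 1 gd = gx := by rw [gd, map_mul, alph1_c, alph1_l]; group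
theorem alph2_d (p) : alph p 2 gd = gy := by rw [gd, map_mul, alph2_c, alph2_l]; group

theorem tau_alph (p : ℕ) (v : Fin 3) :
    tau v * alph p (v + 1) (eps p v) * (tau v)⁻¹ = alph p v (eps p v) := by
  fin_cases v
  · show 1 * alph p 1 gc * 1⁻¹ = alph p 0 gc
    rw [alph1_c, alph0_c]; group
  · show 1 * alph p 2 (gu p) * 1⁻¹ = alph p 1 (gu p)
    rw [gu, map_mul, map_zpow, map_mul, map_zpow, alph2_d, alph1_d, alph2_c, alph1_c, fC]; group
  · show gh * alph p 0 gl * gh⁻¹ = alph p 2 gl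
    rw [alph0_l, alph2_l]

theorem hn_alph (p n : ℕ) (v : Fin 3) (g : F2) :
    hn p n (alph p v g) = bet p n v * g * (bet p n v)⁻¹ := by
  have : (hn p n).comp (alph p v) = (MulAut.conj (bet p n v)).toMonoidHom := by
    fin_cases v
    · apply hom2_ext
      · show hn p n (alph p 0 gc) = 1 * gc * 1⁻¹
        rw [alph0_c, hn_fC]; group
      · show hn p n (alph p 0 gl) = 1 * gl * 1⁻¹
        rw [alph0_l, hn_l]; group
    · apply hom2_ext
      · show hn p n (alph p 1 gc) = gc ^ n * gc * (gc ^ n)⁻¹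
        rw [alph1_c, hn_fC]; group
      · show hn p n (alph p 1 gl) = gc ^ n * gl * (gc ^ n)⁻¹
        rw [alph1_l, map_mul, map_inv, hn_fC, hn_x, gd]; group
    · apply hom2_ext
      · show hn p n (alph p 2 gc) = (gc ^ n * gu p ^ n) * gc * (gc ^ n * gu p ^ n)⁻¹
        rw [alph2_c, map_mul, hn_hlh, hn_y, gd]; group
      · show hn p n (alph p 2 gl) = (gc ^ n * gu p ^ n) * gl * (gc ^ n * gu p ^ n)⁻¹
        rw [alph2_l]
        have := hn_hlh p n
        rw [← inv_inj, ← map_inv]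
        rw [show (gh * gll * gh⁻¹)⁻¹ = gh * gll⁻¹ * gh⁻¹ by group, this]; group
  exact DFunLike.congr_fun this g

theorem bet_tau (p n : ℕ) (v : Fin 3) :
    hn p n (tau v) = bet p n v * eps p v ^ n * (bet p n (v + 1))⁻¹ := by
  fin_cases v
  · show hn p n 1 = 1 * gc ^ n * (gc ^ n)⁻¹
    rw [map_one]; group
  · show hn p n 1 = gc ^ n * gu p ^ n * (gc ^ n * gu p ^ n)⁻¹
    rw [map_one]; group
  · show hn p n gh = gc ^ n * gu p ^ n * gl ^ n * 1⁻¹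
    rw [hn_h]; group

/-! signed versions -/
def nx (v : Fin 3) (s : Bool) : Fin 3 := if s then v + 1 else v - 1
def ebar (p : ℕ) (v : Fin 3) (s : Bool) : F2 := if s then eps p v else (eps p (v - 1))⁻¹
def TT (v : Fin 3) (s : Bool) : F4 := if s then tau v else (tau (v - 1))⁻¹

theorem nx_nx (v s) : nx (nx v s) (!s) = v := by cases s <;> simp [nx]
theorem ebar_nx (p v s) : ebar p (nx v s) (!s) = (ebar p v s)⁻¹ := by cases s <;> simp [nx, ebar]
theorem TT_nx (v s) : TT (nx v s) (!s) = (TT v s)⁻¹ := by cases s <;> simp [nx, TT]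
theorem TT_alph (p : ℕ) (v s) :
    TT v s * alph p (nx v s) (ebar p v s) * (TT v s)⁻¹ = alph p v (ebar p v s) := by
  cases s
  · have := tau_alph p (v - 1)
    simp only [sub_add_cancel] at this
    simp only [TT, nx, ebar, Bool.false_eq_true, if_false, map_inv]
    rw [← this]; group
  · exact tau_alph p v
theorem bet_TT (p n : ℕ) (v s) :
    hn p n (TT v s) = bet p n v * ebar p v s ^ n * (bet p n (nx v s))⁻¹ := by
  cases s
  · have := bet_tau p n (v - 1)
    simp only [sub_add_cancel] at this
    simp only [TT, nx, ebar, Bool.false_eq_true, if_false, map_inv]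
    rw [this]; group
  · exact bet_tau p n v

theorem TT_alph_zpow (p : ℕ) (v s) (k : ℤ) :
    TT v s * alph p (nx v s) (ebar p v s ^ k) * (TT v s)⁻¹ = alph p v (ebar p v s ^ k) := by
  rw [map_zpow, map_zpow, ← TT_alph, conj_zpow]

inductive Pth
  | fin (g : F2) : Pth
  | step (g : F2) (s : Bool) (P : Pth) : Pth

namespace Pth
def val (p : ℕ) : Fin 3 → Pth → F4
  | v, fin g => alph p v g
  | v, step g s P => alph p v g * TT v s * val p (nx v s) P
def endv : Fin 3 → Pth → Fin 3
  | v, fin _ => v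
  | v, step _ s P => endv (nx v s) P
def lmul (a : F2) : Pth → Pth
  | fin g => fin (a * g)
  | step g s P => step (a * g) s P
def cat : Pth → Pth → Pth
  | fin g, Q => lmul g Q
  | step g s P, Q => step g s (cat P Q)
def okNext (p : ℕ) (v : Fin 3) (s : Bool) : Pth → Prop
  | fin _ => True
  | step g' s' _ => ¬ (s' = !s ∧ ∃ k : ℤ, g' = ebar p v s ^ k)
def good (p : ℕ) : Fin 3 → Pth → Prop
  | _, fin _ => True
  | v, step _ s P => okNext p v s P ∧ good p (nx v s) P

theorem val_lmul (p v a P) : val p v (lmul a P) = alph p v a * val p v P := by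
  cases P <;> simp [lmul, val, mul_assoc]
theorem endv_lmul (v a P) : endv v (lmul a P) = endv v P := by
  cases P <;> simp [lmul, endv]
theorem good_lmul (p v a P) (h : good p v P) : good p v (lmul a P) := by
  cases P <;> simpa [lmul, good] using h
theorem val_cat (p) (P Q) : ∀ v, val p v (cat P Q) = val p v P * val p (endv v P) Q := by
  induction P with
  | fin g => intro v; simp [cat, val_lmul, val, endv]
  | step g s P ih => intro v; simp [cat, val, endv, ih, mul_assoc]
theorem endv_cat (P Q) : ∀ v, endv v (cat P Q) = endv (endv v P) Q := by
  induction P with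
  | fin g => intro v; simp [cat, endv_lmul, endv]
  | step g s P ih => intro v; simp [cat, endv, ih]

theorem exists_good (p : ℕ) (P : Pth) : ∀ v, ∃ Q, good p v Q ∧ val p v Q = val p v P ∧
    endv v Q = endv v P := by
  induction P with
  | fin g => intro v; exact ⟨fin g, trivial, rfl, rfl⟩
  | step g s P ih =>
    intro v
    obtain ⟨Q, hQ, hv, he⟩ := ih (nx v s)
    by_cases hok : okNext p v s Q
    · exact ⟨step g s Q, ⟨hok, hQ⟩, by simp [val, hv], by simp [endv, he]⟩
    · cases Q with
      | fin g => exact absurd trivial hok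
      | step g' s' Q =>
        simp only [okNext, not_not] at hok
        obtain ⟨rfl, k, rfl⟩ := hok
        refine ⟨lmul (g * ebar p v s ^ k) Q, ?_, ?_, ?_⟩
        · apply good_lmul
          have := hQ.2
          rwa [nx_nx] at this
        · rw [val_lmul, val, ← hv, val, nx_nx, TT_nx, map_mul, ← TT_alph_zpow]
          group
        · rw [endv_lmul, endv, ← he, endv, nx_nx]

theorem exists_closed (p : ℕ) (W : F4) : ∃ P, val p 0 P = W ∧ endv 0 P = 0 := by
  have n0 : nx 0 true = 1 := rfl
  have n1 : nx 1 true = 2 := rfl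
  have n2 : nx 2 true = 0 := rfl
  have m0 : nx 0 false = 2 := rfl
  have m1 : nx 1 false = 0 := rfl
  have m2 : nx 2 false = 1 := rfl
  have t0 : TT 0 true = 1 := rfl
  have t1 : TT 1 true = 1 := rfl
  have t2 : TT 2 true = gh := rfl
  have s0 : TT 0 false = gh⁻¹ := rfl
  have s1 : TT 1 false = 1 := inv_one
  have s2 : TT 2 false = 1 := inv_one
  induction W using FreeGroup.induction_on with
  | C1 => exact ⟨fin 1, by simp [val], rfl⟩
  | of i =>
    fin_cases i
    · refine ⟨step 1 true (step gd false (fin 1)), ?_, rfl⟩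
      simp only [val, n0, t0, m1, s1, alph1_d, map_one]; simp [gx]
    · refine ⟨step 1 true (step 1 true (step gd false (step 1 false (fin 1)))), ?_, rfl⟩
      simp only [val, n0, t0, m1, s1, n1, t1, m2, s2, alph2_d, map_one]; simp [gy]
    · refine ⟨step 1 true (step 1 true (step 1 true (fin 1))), ?_, rfl⟩
      simp only [val, n0, t0, n1, t1, n2, t2, map_one]; simp [gh]
    · refine ⟨fin gl, ?_, rfl⟩
      simp only [val, alph0_l]; simp [gll]
  | inv_of i _ =>
    fin_cases i
    · refine ⟨step 1 true (step gd⁻¹ false (fin 1)), ?_, rfl⟩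
      simp only [val, n0, t0, m1, s1, alph1_d, map_one, map_inv]; simp [gx]
    · refine ⟨step 1 true (step 1 true (step gd⁻¹ false (step 1 false (fin 1)))), ?_, rfl⟩
      simp only [val, n0, t0, m1, s1, n1, t1, m2, s2, alph2_d, map_one, map_inv]; simp [gy]
    · refine ⟨step 1 false (step 1 false (step 1 false (fin 1))), ?_, rfl⟩
      simp only [val, m0, s0, m1, s1, m2, s2, map_one]; simp [gh]
    · refine ⟨fin gl⁻¹, ?_, rfl⟩
      simp only [val, alph0_l, map_inv]; simp [gll]
  | mul a b ha hb =>
    obtain ⟨P, hP, hP'⟩ := ha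
    obtain ⟨Q, hQ, hQ'⟩ := hb
    exact ⟨cat P Q, by rw [val_cat, hP, hP', hQ], by rw [endv_cat, hP', hQ']⟩

def toL (p : ℕ) : Fin 3 → Pth → List (SL(2, ℤ) × SL(2, ℤ))
  | _, fin _ => []
  | v, step g s P => (rho g, rho (ebar p v s)) :: toL p (nx v s) P
def last : Pth → F2
  | fin g => g
  | step _ _ P => last P

theorem rho_val (p n : ℕ) (P) : ∀ v, rho (hn p n (val p v P)) =
    rho (bet p n v) * bp n (toL p v P) * rho (last P) * (rho (bet p n (endv v P)))⁻¹ := by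
  induction P with
  | fin g => intro v; simp [val, hn_alph, toL, last, endv, bp, mul_assoc]
  | step g s P ih =>
    intro v
    rw [val, map_mul, map_mul, map_mul, ih, map_mul, hn_alph, bet_TT, toL, last, endv, bp]
    simp only [map_mul, map_inv, map_pow]
    group
end Pth
end FAP
end

section
namespace FAP
open scoped Pointwise MatrixGroups
open Filter

def chi (a b : ℤ) : F2 →* Multiplicative ℤ :=
  FreeGroup.lift ![Multiplicative.ofAdd a, Multiplicative.ofAdd b]
theorem chi_c (a b) : (chi a b gc).toAdd = a := by simp [chi, gc]
theorem chi_l (a b) : (chi a b gl).toAdd = b := by simp [chi, gl]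
theorem chi_u (p a b) : (chi a b (gu p)).toAdd = -p * (a + b) + a := by
  simp only [gu, gd, map_mul, map_zpow, toAdd_mul, toAdd_zpow, chi_c, chi_l]
  simp

theorem root_eps (p : ℕ) (v : Fin 3) : IsRootEl (eps p v) := by
  fin_cases v
  · apply isRootEl_of_hom (chi 1 0)
    exact Multiplicative.toAdd.injective (chi_c _ _)
  · apply isRootEl_of_hom (chi 1 (-1))
    exact Multiplicative.toAdd.injective (by
      show (chi 1 (-1) (gu p)).toAdd = _
      rw [chi_u]; simp)
  · apply isRootEl_of_hom (chi 0 1)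
    exact Multiplicative.toAdd.injective (chi_l _ _)

theorem kill_eps (p : ℕ) (hp : 2 ≤ p) (v w : Fin 3) (hvw : v ≠ w) : ∃ χ : F2 →* Multiplicative ℤ,
    χ (eps p v) = 1 ∧ χ (eps p w) ≠ 1 := by
  have key : ∃ a b : ℤ, (chi a b (eps p v)).toAdd = 0 ∧ (chi a b (eps p w)).toAdd ≠ 0 := by
    have e0 : eps p 0 = gc := rfl
    have e1 : eps p 1 = gu p := rfl
    have e2 : eps p 2 = gl := rfl
    have hv : v = 0 ∨ v = 1 ∨ v = 2 := by fin_cases v <;> simp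
    have hw : w = 0 ∨ w = 1 ∨ w = 2 := by fin_cases w <;> simp
    rcases hv with rfl | rfl | rfl
    · refine ⟨0, 1, ?_, ?_⟩
      · rw [e0, chi_c]
      · rcases hw with rfl | rfl | rfl
        · exact absurd rfl hvw
        · rw [e1, chi_u]; simp; omega
        · rw [e2, chi_l]; simp
    · refine ⟨p, 1 - p, ?_, ?_⟩
      · rw [e1, chi_u]; ring
      · rcases hw with rfl | rfl | rfl
        · rw [e0, chi_c]; simp; omega
        · exact absurd rfl hvw
        · rw [e2, chi_l]; omega
    · refine ⟨1, 0, ?_, ?_⟩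
      · rw [e2, chi_l]
      · rcases hw with rfl | rfl | rfl
        · rw [e0, chi_c]; simp
        · rw [e1, chi_u]; simp; omega
        · exact absurd rfl hvw
  obtain ⟨a, b, h1, h2⟩ := key
  exact ⟨chi a b, Multiplicative.toAdd.injective h1, fun h => h2 (by rw [h]; rfl)⟩

theorem root_ebar (p : ℕ) (v s) : ∀ w, Commute (ebar p v s) w → ∃ k : ℤ, w = ebar p v s ^ k := by
  intro w hw
  cases s
  · simp only [ebar, Bool.false_eq_true, if_false] at hw ⊢
    obtain ⟨k, hk⟩ := (root_eps p (v - 1)).2 w (by simpa using hw.inv_left)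
    exact ⟨-k, by rw [hk]; group⟩
  · exact (root_eps p v).2 w hw

theorem not_comm_ebar (p : ℕ) (hp : 2 ≤ p) (v s s') (g' : F2)
    (hok : ¬ (s' = !s ∧ ∃ k : ℤ, g' = ebar p v s ^ k)) :
    ¬ Commute (ebar p v s) (g' * ebar p (nx v s) s' * g'⁻¹) := by
  intro hc
  by_cases hs : s' = !s
  · subst hs
    apply hok
    refine ⟨rfl, ?_⟩
    rw [ebar_nx] at hc
    have hc2 : Commute (ebar p v s) (g' * ebar p v s * g'⁻¹) := by
      have := hc.inv_right
      rwa [show (g' * (ebar p v s)⁻¹ * g'⁻¹)⁻¹ = g' * ebar p v s * g'⁻¹ by group] at this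
    obtain ⟨k, hk⟩ := root_ebar p v s _ hc2
    have h1 : ∃ χ : F2 →* Multiplicative ℤ, χ (ebar p v s) ≠ 1 := by
      cases s
      · obtain ⟨χ, -, h⟩ := kill_eps p hp v (v - 1) (by fin_cases v <;> simp)
        exact ⟨χ, by simpa [ebar] using h⟩
      · obtain ⟨χ, -, h⟩ := kill_eps p hp (v + 1) v (by fin_cases v <;> simp)
        exact ⟨χ, by simpa [ebar] using h⟩
    obtain ⟨χ, hχ⟩ := h1
    have h2 := congrArg (fun z => (χ z).toAdd) hk
    simp only [map_mul, map_inv, map_zpow, toAdd_mul, toAdd_inv, toAdd_zpow] at h2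
    have h3 : (χ (ebar p v s)).toAdd ≠ 0 := fun h => hχ (Multiplicative.toAdd.injective h)
    have hk1 : k = 1 := by
      have : (k - 1) * (χ (ebar p v s)).toAdd = 0 := by
        rw [smul_eq_mul] at h2; linarith
      rcases mul_eq_zero.1 this with h | h
      · omega
      · exact absurd h h3
    rw [hk1, zpow_one] at hk
    apply root_ebar
    have : g' * ebar p v s = ebar p v s * g' := by
      calc g' * ebar p v s = (g' * ebar p v s * g'⁻¹) * g' := by group
        _ = _ := by rw [hk]
    exact this.symm
  · have hs' : s' = s := by cases s <;> cases s' <;> simp_all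
    subst hs'
    obtain ⟨k, hk⟩ := root_ebar p v s' _ hc
    have h1 : ∃ χ : F2 →* Multiplicative ℤ, χ (ebar p v s') = 1 ∧ χ (ebar p (nx v s') s') ≠ 1 := by
      cases s'
      · obtain ⟨χ, h0, h⟩ := kill_eps p hp (v - 1) (v - 1 - 1) (by fin_cases v <;> simp <;> decide)
        exact ⟨χ, by simpa [ebar] using h0, by simpa [ebar, nx] using h⟩
      · obtain ⟨χ, h0, h⟩ := kill_eps p hp v (v + 1) (by fin_cases v <;> simp)
        exact ⟨χ, by simpa [ebar] using h0, by simpa [ebar, nx] using h⟩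
    obtain ⟨χ, h0, hχ⟩ := h1
    apply hχ
    have h2 := congrArg χ hk
    simp only [map_mul, map_inv, map_zpow, h0, one_zpow] at h2
    rwa [mul_inv_eq_one, mul_eq_left] at h2

theorem tr_inv (A : SL(2, ℤ)) : tr A⁻¹ = tr A := by
  unfold tr
  rw [Matrix.SpecialLinearGroup.SL2_inv_expl]
  simp; ring

theorem rho_c : (rho gc : Matrix (Fin 2) (Fin 2) ℤ) = !![5, 2; 2, 1] := by
  have : rho gc = sA * sB := by simp [rho, gc]
  rw [this, Matrix.SpecialLinearGroup.coe_mul, sA_coe, sB_coe]; simp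
theorem rho_l : (rho gl : Matrix (Fin 2) (Fin 2) ℤ) = !![9, 4; 2, 1] := by
  have : rho gl = sA * (sA * sB) := by simp [rho, gl]
  rw [this, Matrix.SpecialLinearGroup.coe_mul, Matrix.SpecialLinearGroup.coe_mul, sA_coe, sB_coe]
  simp
theorem rho_d : (rho gd : Matrix (Fin 2) (Fin 2) ℤ) = !![49, 22; 20, 9] := by
  rw [gd, map_mul, Matrix.SpecialLinearGroup.coe_mul, rho_c, rho_l]; simp

theorem rho_d_pow (m : ℕ) : ∃ a b c d : ℤ, (rho (gd ^ m) : Matrix (Fin 2) (Fin 2) ℤ) =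
    !![a, b; c, d] ∧ 1 ≤ a ∧ 0 ≤ b ∧ 0 ≤ c ∧ 1 ≤ d := by
  induction m with
  | zero => exact ⟨1, 0, 0, 1, by
      rw [pow_zero, map_one, Matrix.SpecialLinearGroup.coe_one, Matrix.one_fin_two], by simp⟩
  | succ m ih =>
    obtain ⟨a, b, c, d, h, ha, hb, hc, hd⟩ := ih
    refine ⟨49 * a + 20 * b, 22 * a + 9 * b, 49 * c + 20 * d, 22 * c + 9 * d, ?_, by omega,
      by omega, by omega, by omega⟩
    rw [pow_succ, map_mul, Matrix.SpecialLinearGroup.coe_mul, h, rho_d]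
    simp [Matrix.mul_fin_two, mul_comm]

theorem tr_eps (p : ℕ) (hp : 2 ≤ p) (v : Fin 3) : 3 ≤ tr (rho (eps p v)) := by
  fin_cases v
  · show 3 ≤ (rho gc : Matrix (Fin 2) (Fin 2) ℤ) 0 0 + (rho gc : Matrix (Fin 2) (Fin 2) ℤ) 1 1
    rw [rho_c]; simp
  · have h : (gu p)⁻¹ = gl * gd ^ (p - 1) := by
      rw [gu_eq, ← zpow_natCast, Nat.cast_sub (by omega)]; simp [← zpow_neg]
    show 3 ≤ tr (rho (gu p))
    rw [← tr_inv, ← map_inv, h]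
    obtain ⟨a, b, c, d, h, ha, hb, hc, hd⟩ := rho_d_pow (p - 1)
    show 3 ≤ (rho (gl * gd ^ (p - 1)) : Matrix (Fin 2) (Fin 2) ℤ) 0 0 +
      (rho (gl * gd ^ (p - 1)) : Matrix (Fin 2) (Fin 2) ℤ) 1 1
    rw [map_mul, Matrix.SpecialLinearGroup.coe_mul, h, rho_l]
    simp [Matrix.mul_fin_two]
    omega
  · show 3 ≤ (rho gl : Matrix (Fin 2) (Fin 2) ℤ) 0 0 + (rho gl : Matrix (Fin 2) (Fin 2) ℤ) 1 1
    rw [rho_l]; simp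

theorem tr_ebar (p : ℕ) (hp : 2 ≤ p) (v s) : 3 ≤ tr (rho (ebar p v s)) := by
  cases s
  · simp only [ebar, Bool.false_eq_true, if_false]
    rw [map_inv, tr_inv]; exact tr_eps p hp _
  · exact tr_eps p hp v

namespace Pth
theorem toL_tr (p : ℕ) (hp : 2 ≤ p) (P) : ∀ v, ∀ x ∈ toL p v P, 3 ≤ tr x.2 := by
  induction P with
  | fin g => intro v x hx; simp [toL] at hx
  | step g s P ih =>
    intro v x hx
    simp only [toL, List.mem_cons] at hx
    rcases hx with rfl | hx
    · exact tr_ebar p hp v s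
    · exact ih _ x hx

theorem toL_chain (p : ℕ) (hp : 2 ≤ p) (P) : ∀ v, good p v P → List.IsChain nonComm (toL p v P) := by
  induction P with
  | fin g => intro v _; simp [toL]
  | step g s P ih =>
    intro v h
    have h2 := ih _ h.2
    cases P with
    | fin g' => simp [toL]
    | step g' s' P =>
      simp only [toL] at h2 ⊢
      refine List.IsChain.cons_cons ?_ h2
      have := not_comm_ebar p hp v s s' g' h.1
      intro hc
      apply this
      apply rho_injective
      simpa [map_mul, map_inv] using hc.eq
end Pth

theorem hn_discriminate (p : ℕ) (hp : 2 ≤ p) (W : F4) (hW : W ≠ 1) :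
    ∀ᶠ n in atTop, hn p n W ≠ 1 := by
  obtain ⟨P, hP, hE⟩ := Pth.exists_closed p W
  obtain ⟨Q, hQ, hv, he⟩ := Pth.exists_good p P 0
  rw [hP] at hv
  rw [hE] at he
  by_cases hL : Pth.toL p 0 Q = []
  · cases Q with
    | step => simp [Pth.toL] at hL
    | fin g =>
      simp only [Pth.val] at hv
      have : ∀ n, hn p n W = g := by
        intro n; rw [← hv, hn_alph]; simp [bet]
      filter_upwards with n
      rw [this]
      rintro rfl
      exact hW (by rw [← hv, map_one])
  · filter_upwards [bp_ne _ hL (Pth.toL_tr p hp Q 0) (Pth.toL_chain p hp Q 0 hQ) (rho Q.last)⁻¹]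
      with n hn hc
    apply hn
    have := Pth.rho_val p n Q 0
    rw [hv, hc, he] at this
    simp only [bet, map_one, one_mul, inv_one, mul_one] at this
    exact eq_inv_of_mul_eq_one_left this.symm

theorem retract_discriminate (p : ℕ) (hp : 2 ≤ p) (S : Set F4) (hS : S.Finite) (h1 : ∀ W ∈ S, W ≠ 1) :
    ∃ r : F4 →* F2, (∀ g, r (alph p 0 g) = g) ∧ ∀ W ∈ S, r W ≠ 1 := by
  have : ∀ᶠ n in atTop, ∀ W ∈ S, hn p n W ≠ 1 := by
    rw [Filter.eventually_all_finite hS]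
    exact fun W hW => hn_discriminate p hp W (h1 W hW)
  obtain ⟨n, hn'⟩ := this.exists
  exact ⟨hn p n, fun g => by rw [hn_alph]; simp [bet], hn'⟩
end FAP
end

section
namespace FAP
open scoped MatrixGroups

section noeth
variable {ι : Type}

abbrev RR (ι : Type) := MvPolynomial (ι × Fin 2 × Fin 2) ℤ

noncomputable def genM (i : ι) : Matrix (Fin 2) (Fin 2) (RR ι) :=
  Matrix.of fun a b => MvPolynomial.X (i, a, b)

noncomputable def wordM (w : FreeGroup ι) [DecidableEq ι] : Matrix (Fin 2) (Fin 2) (RR ι) :=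
  (w.toWord.map fun x => cond x.2 (genM x.1) (genM x.1).adjugate).prod

noncomputable def evM (v : ι → SL(2, ℤ)) : RR ι →+* ℤ :=
  MvPolynomial.eval (fun x => (v x.1 : Matrix (Fin 2) (Fin 2) ℤ) x.2.1 x.2.2)

theorem evM_gen (v : ι → SL(2, ℤ)) (i : ι) :
    (evM v).mapMatrix (genM i) = (v i : Matrix (Fin 2) (Fin 2) ℤ) := by
  ext a b; simp [evM, genM]

theorem evM_word [DecidableEq ι] (v : ι → SL(2, ℤ)) (w : FreeGroup ι) :
    (evM v).mapMatrix (wordM w) = (FreeGroup.lift v w : Matrix (Fin 2) (Fin 2) ℤ) := by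
  conv_rhs => rw [← FreeGroup.mk_toWord (x := w), FreeGroup.lift_mk]
  unfold wordM
  rw [map_list_prod]
  induction w.toWord with
  | nil => simp
  | cons x L ih =>
    simp only [List.map_cons, List.prod_cons]
    rw [ih, Matrix.SpecialLinearGroup.coe_mul]
    congr 1
    rcases x with ⟨i, _ | _⟩
    · simp only [cond_false]
      rw [RingHom.map_adjugate, evM_gen, Matrix.SpecialLinearGroup.coe_inv]
    · simp only [cond_true]; exact evM_gen v i

noncomputable def wI [DecidableEq ι] (N : Finset (FreeGroup ι)) : Ideal (RR ι) :=
  Ideal.span {q | ∃ w ∈ N, ∃ a b, q = (wordM w - 1) a b}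

theorem solve_iff [DecidableEq ι] (v : ι → SL(2, ℤ)) (w : FreeGroup ι) :
    FreeGroup.lift v w = 1 ↔ ∀ a b, evM v ((wordM w - 1) a b) = 0 := by
  have h : ∀ a b, evM v ((wordM w - 1) a b) =
      ((FreeGroup.lift v w : Matrix (Fin 2) (Fin 2) ℤ) - 1) a b := by
    intro a b
    have := evM_word v w
    have h2 : (evM v).mapMatrix (wordM w - 1) = (FreeGroup.lift v w : Matrix (Fin 2) (Fin 2) ℤ) - 1 := by
      rw [map_sub, this, map_one]
    rw [← h2]; rfl
  simp only [h]
  constructor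
  · intro h a b; rw [h]; simp
  · intro h
    apply Subtype.ext
    rw [← sub_eq_zero]
    ext a b; exact h a b

theorem noeth_SL [Finite ι] (N : Set (FreeGroup ι)) : ∃ N0 : Finset (FreeGroup ι), ↑N0 ⊆ N ∧
    ∀ v : ι → SL(2, ℤ), (∀ w ∈ N0, FreeGroup.lift v w = 1) → ∀ w ∈ N, FreeGroup.lift v w = 1 := by
  classical
  obtain ⟨J, ⟨N0, hN0, rfl⟩, hmax⟩ := set_has_maximal_iff_noetherian.2
    (inferInstance : IsNoetherian (RR ι) (RR ι))
    {J | ∃ N0 : Finset (FreeGroup ι), ↑N0 ⊆ N ∧ J = wI N0} ⟨wI ∅, ∅, by simp, rfl⟩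
  refine ⟨N0, hN0, fun v hv w hw => ?_⟩
  have hle : wI N0 ≤ wI (insert w N0) := Ideal.span_mono (by
    rintro q ⟨w', hw', h⟩; exact ⟨w', Finset.mem_insert_of_mem hw', h⟩)
  have heq : wI (insert w N0) ≤ wI N0 := by
    by_contra hcon
    refine hmax (wI (insert w N0)) ⟨_, ?_, rfl⟩ (lt_of_le_not_ge hle hcon)
    intro z hz
    simp only [Finset.coe_insert, Set.mem_insert_iff] at hz
    rcases hz with rfl | hz
    · exact hw
    · exact hN0 hz
  have hker : wI N0 ≤ RingHom.ker (evM v) := by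
    unfold wI
    rw [Ideal.span_le]
    rintro q ⟨w', hw', a, b, rfl⟩
    exact (solve_iff v w').1 (hv w' hw') a b
  rw [solve_iff]
  intro a b
  apply hker
  apply heq
  exact Ideal.subset_span ⟨w, Finset.mem_insert_self _ _, a, b, rfl⟩

theorem noeth_F4 [Finite ι] (N : Set (FreeGroup ι)) : ∃ N0 : Finset (FreeGroup ι), ↑N0 ⊆ N ∧
    ∀ v : ι → F4, (∀ w ∈ N0, FreeGroup.lift v w = 1) → ∀ w ∈ N, FreeGroup.lift v w = 1 := by
  obtain ⟨N0, h1, h2⟩ := noeth_SL N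
  refine ⟨N0, h1, fun v hv w hw => ?_⟩
  by_contra hne
  obtain ⟨r, -, hr⟩ := retract_discriminate 2 le_rfl {FreeGroup.lift v w} (Set.finite_singleton _)
    (by simpa using hne)
  apply hr _ rfl
  apply rho_injective
  have hcomp : ∀ w, rho (r (FreeGroup.lift v w)) = FreeGroup.lift (fun i => rho (r (v i))) w := by
    intro w
    have : (rho.comp r).comp (FreeGroup.lift v) = FreeGroup.lift (fun i => rho (r (v i))) := by
      ext1 i; simp
    exact DFunLike.congr_fun this w
  rw [hcomp, map_one]
  apply h2 _ _ w hw
  intro w' hw'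
  rw [← hcomp, hv w' hw', map_one, map_one]
end noeth
end FAP
end

section
namespace FAP
open FirstOrder FirstOrder.Language

/-! terms -/
theorem exists_term {α : Type} (w : FreeGroup α) : ∃ t : Lgp.Term α,
    ∀ (G : Type) [Group G] (v : α → G), t.realize v = FreeGroup.lift v w := by
  have hmul : ∀ a b : FreeGroup α, (∃ t : Lgp.Term α,
      ∀ (G : Type) [Group G] (v : α → G), t.realize v = FreeGroup.lift v a) → (∃ t : Lgp.Term α,
      ∀ (G : Type) [Group G] (v : α → G), t.realize v = FreeGroup.lift v b) → (∃ t : Lgp.Term α,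
      ∀ (G : Type) [Group G] (v : α → G), t.realize v = FreeGroup.lift v (a * b)) := by
    rintro a b ⟨t, ht⟩ ⟨s, hs⟩
    refine ⟨Term.func (L := Lgp) (GroupFn.mul : GroupFn 2) ![t, s], fun G _ v => ?_⟩
    rw [map_mul, ← ht, ← hs]; rfl
  have hinv : ∀ a : FreeGroup α, (∃ t : Lgp.Term α,
      ∀ (G : Type) [Group G] (v : α → G), t.realize v = FreeGroup.lift v a) → (∃ t : Lgp.Term α,
      ∀ (G : Type) [Group G] (v : α → G), t.realize v = FreeGroup.lift v a⁻¹) := by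
    rintro a ⟨t, ht⟩
    refine ⟨Term.func (L := Lgp) (GroupFn.inv : GroupFn 1) ![t], fun G _ v => ?_⟩
    rw [map_inv, ← ht]; rfl
  induction w using FreeGroup.induction_on with
  | C1 =>
    refine ⟨Term.func (L := Lgp) (GroupFn.one : GroupFn 0) ![], fun G _ v => ?_⟩
    rw [map_one]; rfl
  | of i => exact ⟨Term.var i, fun G _ v => by simp⟩
  | inv_of i h => exact hinv _ h
  | mul a b ha hb => exact hmul a b ha hb

theorem realize_hom {α A B : Type} [Group A] [Group B] (f : A →* B) (t : Lgp.Term α) (v : α → A) :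
    t.realize (f ∘ v) = f (t.realize v) := by
  induction t with
  | var i => rfl
  | func g ts ih =>
    simp only [Term.realize, ih]
    cases g with
    | one => exact (map_one f).symm
    | inv => exact (map_inv f _).symm
    | mul => exact (map_mul f _ _).symm

/-! criterion for forall-embeddings -/
theorem qf_hom {α A B : Type} [Group A] [Group B] {n : ℕ} (ψ : Lgp.BoundedFormula α n)
    (hψ : ψ.IsQF) (v : α → B) (xs : Fin n → B) : ∃ S : Set B, S.Finite ∧ (∀ W ∈ S, W ≠ 1) ∧
    ∀ r : B →* A, (∀ W ∈ S, r W ≠ 1) → (ψ.Realize v xs ↔ ψ.Realize (r ∘ v) (r ∘ xs)) := by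
  induction hψ with
  | falsum => exact ⟨∅, Set.finite_empty, by simp, fun r _ => Iff.rfl⟩
  | of_isAtomic h =>
    cases h with
    | rel R ts => exact Empty.elim R
    | equal t₁ t₂ =>
      set a := t₁.realize (Sum.elim v xs) with ha
      set b := t₂.realize (Sum.elim v xs) with hb
      refine ⟨{W | W = a * b⁻¹ ∧ W ≠ 1}, (Set.finite_singleton (a * b⁻¹)).subset (fun W h => h.1),
        fun W h => h.2, fun r hr => ?_⟩
      rw [BoundedFormula.realize_bdEqual, BoundedFormula.realize_bdEqual, ← Sum.comp_elim,
        realize_hom, realize_hom, ← ha, ← hb]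
      constructor
      · intro h; rw [h]
      · intro h
        by_contra hne
        refine hr (a * b⁻¹) ⟨rfl, fun h1 => hne (mul_inv_eq_one.1 h1)⟩ ?_
        rw [map_mul, map_inv, h, mul_inv_cancel]
  | imp _ _ ih1 ih2 =>
    obtain ⟨S1, f1, n1, h1⟩ := ih1
    obtain ⟨S2, f2, n2, h2⟩ := ih2
    refine ⟨S1 ∪ S2, f1.union f2, ?_, fun r hr => ?_⟩
    · rintro W (h | h)
      · exact n1 W h
      · exact n2 W h
    · rw [BoundedFormula.realize_imp, BoundedFormula.realize_imp,
        h1 r fun W h => hr W (Or.inl h), h2 r fun W h => hr W (Or.inr h)]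

theorem forallEmb_of_retract {A B : Type} [Group A] [Group B] (f : A →* B)
    (h : ∀ S : Set B, S.Finite → (∀ W ∈ S, W ≠ 1) →
      ∃ r : B →* A, (∀ g, r (f g) = g) ∧ ∀ W ∈ S, r W ≠ 1) : IsForallEmbedding f := by
  constructor
  · obtain ⟨r, hr, -⟩ := h ∅ Set.finite_empty (by simp)
    exact Function.LeftInverse.injective hr
  · rintro k φ ⟨n, ψ, hψ, rfl⟩ a ha
    rw [BoundedFormula.realize_alls] at ha ⊢
    intro xs
    obtain ⟨S, hf, h1, h2⟩ := qf_hom (A := A) ψ hψ (f ∘ a) xs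
    obtain ⟨r, hr, hr2⟩ := h S hf h1
    rw [h2 r hr2]
    have : r ∘ f ∘ a = a := by ext i; exact hr _
    rw [this]
    exact ha _

/-! consequence of forall-embeddings -/
theorem exists_qf_words {α : Type} {n : ℕ} (l : List (FreeGroup (α ⊕ Fin n))) :
    ∃ ψ : Lgp.BoundedFormula α n, ψ.IsQF ∧ ∀ (G : Type) [Group G] (v : α → G) (xs : Fin n → G),
      ψ.Realize v xs ↔ ∀ w ∈ l, FreeGroup.lift (Sum.elim v xs) w = 1 := by
  induction l with
  | nil => exact ⟨⊤, BoundedFormula.IsQF.top, fun G _ v xs => by simp⟩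
  | cons w l ih =>
    obtain ⟨ψ, hψ, h⟩ := ih
    obtain ⟨t, ht⟩ := exists_term w
    obtain ⟨s, hs⟩ := exists_term (1 : FreeGroup (α ⊕ Fin n))
    refine ⟨(t.bdEqual s) ⊓ ψ, (BoundedFormula.IsAtomic.equal t s).isQF.inf hψ, fun G _ v xs => ?_⟩
    rw [BoundedFormula.realize_inf, BoundedFormula.realize_bdEqual, ht, hs, h, map_one,
      List.forall_mem_cons]

theorem forallEmb_solve {A B : Type} [Group A] [Group B] {f : A →* B} (hf : IsForallEmbedding f)
    {k n : ℕ} (N : Finset (FreeGroup (Fin k ⊕ Fin n))) (a : Fin k → A) (b : Fin n → B)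
    (hb : ∀ w ∈ N, FreeGroup.lift (Sum.elim (f ∘ a) b) w = 1) :
    ∃ b' : Fin n → A, ∀ w ∈ N, FreeGroup.lift (Sum.elim a b') w = 1 := by
  obtain ⟨ψ, hψ, h⟩ := exists_qf_words N.toList
  by_contra hcon
  push Not at hcon
  have := hf.2 k (ψ.not).alls ⟨n, ψ.not, hψ.not, rfl⟩ a (by
    rw [BoundedFormula.realize_alls]
    intro xs
    rw [BoundedFormula.realize_not, h]
    intro hc
    obtain ⟨w, hw, hw'⟩ := hcon xs
    exact hw' (hc w (by simpa using hw)))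
  rw [BoundedFormula.realize_alls] at this
  apply this b
  rw [h]
  intro w hw
  exact hb w (by simpa using hw)

theorem exists_retraction {B : Type} [Group B] (hB : Group.FG B) (g : F4 →* B)
    (hg : IsForallEmbedding g) : ∃ r : B →* F4, ∀ x, r (g x) = x := by
  obtain ⟨S, hS⟩ := hB.out
  let m := Fintype.card S
  let b : Fin m → B := fun i => ((Fintype.equivFin S).symm i : B)
  let a : Fin 4 → F4 := FreeGroup.of
  let π : FreeGroup (Fin 4 ⊕ Fin m) →* B := FreeGroup.lift (Sum.elim (g ∘ a) b)
  have hπ : Function.Surjective π := by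
    rw [← MonoidHom.range_eq_top, eq_top_iff, ← hS, Subgroup.closure_le]
    intro s hs
    refine ⟨FreeGroup.of (Sum.inr (Fintype.equivFin S ⟨s, hs⟩)), ?_⟩
    simp [π, b]
  obtain ⟨N0, hN0, hsol⟩ := noeth_F4 (ι := Fin 4 ⊕ Fin m) (π.ker : Set _)
  obtain ⟨b', hb'⟩ := forallEmb_solve hg N0 a b (fun w hw => hN0 hw)
  have hker := hsol _ hb'
  let r := MonoidHom.liftOfSurjective π hπ ⟨FreeGroup.lift (Sum.elim a b'), hker⟩
  have hr : ∀ w, r (π w) = FreeGroup.lift (Sum.elim a b') w := fun w =>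
    MonoidHom.liftOfRightInverse_comp_apply _ _ _ _ _
  refine ⟨r, fun x => ?_⟩
  have : (r.comp g) = MonoidHom.id F4 := by
    ext i
    have h1 : g (FreeGroup.of i) = π (FreeGroup.of (Sum.inl i)) := by simp [π, a]
    show r (g (FreeGroup.of i)) = FreeGroup.of i
    rw [h1, hr]; simp [a]
  exact DFunLike.congr_fun this x
end FAP
end

section
namespace FAP
open FirstOrder FirstOrder.Language

abbrev GPred (n : ℕ) := ∀ (G : Type) [Group G], (Fin n → G) → Prop
abbrev GTerm (n : ℕ) := ∀ (G : Type) [Group G], (Fin n → G) → G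

def Tm (n : ℕ) (t : GTerm n) : Prop :=
  ∃ w : FreeGroup (Fin n), ∀ (G : Type) [Group G] (v : Fin n → G), t G v = FreeGroup.lift v w

def Df (n : ℕ) (P : GPred n) : Prop :=
  ∃ φ : Lgp.BoundedFormula Empty n, ∀ (G : Type) [Group G] (v : Fin n → G),
    φ.Realize Empty.elim v ↔ P G v

theorem Tm.var {n : ℕ} (i : Fin n) : Tm n (fun _ _ v => v i) :=
  ⟨FreeGroup.of i, fun _ _ _ => by simp⟩
theorem Tm.mul {n : ℕ} {s t : GTerm n} (hs : Tm n s) (ht : Tm n t) :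
    Tm n (fun G _ v => s G v * t G v) := by
  obtain ⟨a, ha⟩ := hs
  obtain ⟨b, hb⟩ := ht
  exact ⟨a * b, fun G _ v => by beta_reduce; rw [ha, hb, map_mul]⟩
theorem Tm.inv {n : ℕ} {s : GTerm n} (hs : Tm n s) : Tm n (fun G _ v => (s G v)⁻¹) := by
  obtain ⟨a, ha⟩ := hs
  exact ⟨a⁻¹, fun G _ v => by beta_reduce; rw [ha, map_inv]⟩
theorem Tm.zpow {n : ℕ} {s : GTerm n} (e : ℤ) (hs : Tm n s) : Tm n (fun G _ v => (s G v) ^ e) := by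
  obtain ⟨a, ha⟩ := hs
  exact ⟨a ^ e, fun G _ v => by beta_reduce; rw [ha, map_zpow]⟩
theorem Tm.pow {n : ℕ} {s : GTerm n} (e : ℕ) (hs : Tm n s) : Tm n (fun G _ v => (s G v) ^ e) := by
  obtain ⟨a, ha⟩ := hs
  exact ⟨a ^ e, fun G _ v => by beta_reduce; rw [ha, map_pow]⟩
theorem Tm.wkn {n : ℕ} {s : GTerm n} (hs : Tm n s) :
    Tm (n + 1) (fun G _ v => s G (fun i => v i.castSucc)) := by
  obtain ⟨a, ha⟩ := hs
  refine ⟨FreeGroup.map Fin.castSucc a, fun G _ v => ?_⟩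
  beta_reduce
  rw [ha]
  have : (FreeGroup.lift v).comp (FreeGroup.map Fin.castSucc) =
      FreeGroup.lift (fun i : Fin n => v i.castSucc) := by
    ext i; simp
  exact (DFunLike.congr_fun this a).symm

theorem Df.eq {n : ℕ} {s t : GTerm n} (hs : Tm n s) (ht : Tm n t) :
    Df n (fun G _ v => s G v = t G v) := by
  obtain ⟨a, ha⟩ := hs
  obtain ⟨b, hb⟩ := ht
  obtain ⟨a', ha'⟩ := exists_term (FreeGroup.map (Sum.inr : Fin n → Empty ⊕ Fin n) a)
  obtain ⟨b', hb'⟩ := exists_term (FreeGroup.map (Sum.inr : Fin n → Empty ⊕ Fin n) b)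
  refine ⟨a'.bdEqual b', fun G _ v => ?_⟩
  beta_reduce
  rw [BoundedFormula.realize_bdEqual, ha', hb', ha, hb]
  have : ∀ w : FreeGroup (Fin n), FreeGroup.lift (Sum.elim Empty.elim v)
      (FreeGroup.map (Sum.inr : Fin n → Empty ⊕ Fin n) w) = FreeGroup.lift v w := by
    intro w
    have : (FreeGroup.lift (Sum.elim Empty.elim v)).comp
      (FreeGroup.map (Sum.inr : Fin n → Empty ⊕ Fin n)) = FreeGroup.lift v := by
      ext i; simp
    exact DFunLike.congr_fun this w
  rw [this, this]

theorem Df.and {n : ℕ} {P Q : GPred n} (hP : Df n P) (hQ : Df n Q) :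
    Df n (fun G _ v => P G v ∧ Q G v) := by
  obtain ⟨a, ha⟩ := hP
  obtain ⟨b, hb⟩ := hQ
  exact ⟨a ⊓ b, fun G _ v => by rw [BoundedFormula.realize_inf, ha, hb]⟩
theorem Df.or {n : ℕ} {P Q : GPred n} (hP : Df n P) (hQ : Df n Q) :
    Df n (fun G _ v => P G v ∨ Q G v) := by
  obtain ⟨a, ha⟩ := hP
  obtain ⟨b, hb⟩ := hQ
  exact ⟨a ⊔ b, fun G _ v => by rw [BoundedFormula.realize_sup, ha, hb]⟩
theorem Df.imp {n : ℕ} {P Q : GPred n} (hP : Df n P) (hQ : Df n Q) :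
    Df n (fun G _ v => P G v → Q G v) := by
  obtain ⟨a, ha⟩ := hP
  obtain ⟨b, hb⟩ := hQ
  exact ⟨a.imp b, fun G _ v => by rw [BoundedFormula.realize_imp, ha, hb]⟩
theorem Df.not {n : ℕ} {P : GPred n} (hP : Df n P) : Df n (fun G _ v => ¬ P G v) := by
  obtain ⟨a, ha⟩ := hP
  exact ⟨a.not, fun G _ v => by rw [BoundedFormula.realize_not, ha]⟩
theorem Df.all {n : ℕ} {P : ∀ (G : Type) [Group G], (Fin n → G) → G → Prop}
    (hP : Df (n + 1) (fun G _ v => P G (fun i => v i.castSucc) (v (Fin.last n)))) :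
    Df n (fun G _ v => ∀ a : G, P G v a) := by
  obtain ⟨a, ha⟩ := hP
  refine ⟨a.all, fun G _ v => ?_⟩
  rw [BoundedFormula.realize_all]
  simp only [ha, Fin.snoc_castSucc, Fin.snoc_last]
theorem Df.ex {n : ℕ} {P : ∀ (G : Type) [Group G], (Fin n → G) → G → Prop}
    (hP : Df (n + 1) (fun G _ v => P G (fun i => v i.castSucc) (v (Fin.last n)))) :
    Df n (fun G _ v => ∃ a : G, P G v a) := by
  obtain ⟨a, ha⟩ := hP
  refine ⟨a.ex, fun G _ v => ?_⟩
  rw [BoundedFormula.realize_ex]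
  simp only [ha, Fin.snoc_castSucc, Fin.snoc_last]
theorem Df.forall_nat {n : ℕ} (R : ℕ) {P : ℕ → GPred n} (h : ∀ m, Df n (P m)) :
    Df n (fun G _ v => ∀ m : ℕ, 2 ≤ m → m ≤ R → P m G v) := by
  choose φ hφ using h
  refine ⟨BoundedFormula.iInf (fun i : Finset.Icc 2 R => φ i), fun G _ v => ?_⟩
  rw [BoundedFormula.realize_iInf]
  simp only [hφ]
  constructor
  · intro h m h1 h2; exact h ⟨m, by simp [h1, h2]⟩
  · intro h b
    have := b.2
    simp only [Finset.mem_Icc] at this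
    exact h b this.1 this.2
theorem Df.exists_int {n : ℕ} (K : ℕ) {P : ℤ → GPred n} (h : ∀ m, Df n (P m)) :
    Df n (fun G _ v => ∃ m : ℤ, |m| ≤ K ∧ P m G v) := by
  choose φ hφ using h
  refine ⟨BoundedFormula.iSup (fun i : Finset.Icc (-K : ℤ) K => φ i), fun G _ v => ?_⟩
  rw [BoundedFormula.realize_iSup]
  simp only [hφ, abs_le]
  constructor
  · rintro ⟨b, h⟩
    have := b.2
    simp only [Finset.mem_Icc] at this
    exact ⟨b, this, h⟩
  · rintro ⟨m, h1, h2⟩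
    exact ⟨⟨m, by simp [h1]⟩, h2⟩

theorem Df.transfer {P : GPred 0} (hP : Df 0 P) {B : Type} [Group B] (hB : IsElementaryFree B)
    (h : P F2 Fin.elim0) : P B Fin.elim0 := by
  obtain ⟨φ, hφ⟩ := hP
  have h1 : ∀ (G : Type) [Group G], Sentence.Realize (L := Lgp) G φ ↔ P G Fin.elim0 := by
    intro G _
    rw [← hφ G Fin.elim0]
    unfold Sentence.Realize Formula.Realize
    rw [Subsingleton.elim (default : Empty → G) Empty.elim,
      Subsingleton.elim (default : Fin 0 → G) Fin.elim0]
  rw [← h1, hB.realize_sentence]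
  exact (h1 _).2 h

theorem Df.conjComm {n : ℕ} {s t : GTerm n} (hs : Tm n s) (ht : Tm n t) :
    Df n (fun G _ v => ConjComm (s G v) (t G v)) := by
  unfold ConjComm
  apply Df.ex
  have hk := Tm.var (Fin.last n)
  have hc := (hk.mul ht.wkn).mul hk.inv
  exact Df.eq (hs.wkn.mul hc) (hc.mul hs.wkn)

theorem Df.psi {n : ℕ} (K R : ℕ) (e e' : ℤ) {s t : GTerm n} (hs : Tm n s) (ht : Tm n t) :
    Df n (fun G _ v => Psi K R e e' (s G v) (t G v)) := by
  unfold Psi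
  apply Df.ex
  apply Df.ex
  have hk := (Tm.var (Fin.last n)).wkn
  have hu := Tm.var (Fin.last (n + 1))
  have hz := hs.wkn.wkn
  have hc := (hk.mul ht.wkn.wkn).mul hk.inv
  refine Df.and (Df.eq (hz.mul hu) (hu.mul hz)) ?_
  refine Df.and (Df.eq (hc.mul hu) (hu.mul hc)) ?_
  refine Df.and (Df.eq (hz.mul hc) (hc.mul hz)) ?_
  refine Df.and (Df.exists_int K fun j => Df.eq ((hz.zpow e).mul (hc.zpow (-e'))) (hu.zpow j)) ?_
  refine Df.forall_nat R fun m => Df.all (Df.not (Df.eq ((Tm.var (Fin.last (n + 2))).pow m) hu.wkn))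

theorem Df.sig (K R : ℕ) (p p' : ℤ) : Df 0 (fun G _ _ => Sig G K R p p') := by
  unfold Sig
  iterate 7 apply Df.all
  have hx : Tm 7 (fun _ _ v => v 0) := Tm.var 0
  have hy : Tm 7 (fun _ _ v => v 1) := Tm.var 1
  have hh : Tm 7 (fun _ _ v => v 2) := Tm.var 2
  have hl : Tm 7 (fun _ _ v => v 3) := Tm.var 3
  have hx' : Tm 7 (fun _ _ v => v 4) := Tm.var 4
  have hy' : Tm 7 (fun _ _ v => v 5) := Tm.var 5
  have hh' : Tm 7 (fun _ _ v => v 6) := Tm.var 6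
  refine Df.imp (Df.eq (((hx.zpow p).mul (hy.zpow _)).mul ((hh.mul hl.inv).mul hh.inv))
    (((hx'.zpow p').mul (hy'.zpow _)).mul ((hh'.mul hl.inv).mul hh'.inv))) ?_
  exact Df.or (Df.conjComm hx hy) (Df.or (Df.conjComm hx' hy') (Df.or (Df.psi K R _ _ hx hx')
    (Df.or (Df.psi K R _ _ hx hy') (Df.or (Df.psi K R _ _ hy hx') (Df.psi K R _ _ hy hy')))))

def Tau (G : Type) [Group G] (n : ℕ) : Prop :=
  ∀ z w : G, z * w = w * z → (∀ m : ℕ, 2 ≤ m → m ≤ n → ∀ s : G, ¬ (s ^ m = z)) →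
    ∃ i : ℤ, |i| ≤ (n : ℤ) ∧ ∃ s : G, z * s = s * z ∧ w = z ^ i * s ^ n

theorem Df.tau (n : ℕ) : Df 0 (fun G _ _ => Tau G n) := by
  unfold Tau
  iterate 2 apply Df.all
  have hz : Tm 2 (fun _ _ v => v 0) := Tm.var 0
  have hw : Tm 2 (fun _ _ v => v 1) := Tm.var 1
  refine Df.imp (Df.eq (hz.mul hw) (hw.mul hz)) (Df.imp (Df.forall_nat n fun m => Df.all
    (Df.not (Df.eq ((Tm.var (Fin.last 2)).pow m) hz.wkn))) (Df.exists_int n fun i => Df.ex ?_))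
  have hs := Tm.var (Fin.last 2)
  exact Df.and (Df.eq (hz.wkn.mul hs) (hs.mul hz.wkn))
    (Df.eq hw.wkn ((hz.wkn.zpow i).mul (hs.pow n)))

theorem tau_free (n : ℕ) (hn : 1 ≤ n) : Tau F2 n := by
  intro z w hzw hpow
  rcases Nat.lt_or_ge 1 n with h2 | h2
  swap
  · obtain rfl : n = 1 := by omega
    exact ⟨0, by simp, w, hzw, by simp⟩
  have hz : z ≠ 1 := by
    rintro rfl
    exact hpow 2 le_rfl h2 1 (by simp)
  obtain ⟨U, k, hU, rfl, hk⟩ := exists_root hz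
  obtain ⟨b, rfl⟩ := hU.2 w (commute_of_pow hk hzw)
  have hcop : IsCoprime k (n : ℤ) := by
    rw [Int.isCoprime_iff_gcd_eq_one]
    by_contra hg
    set g := Int.gcd k n with hgdef
    have hg0 : g ≠ 0 := by rw [hgdef, Ne, Int.gcd_eq_zero_iff]; tauto
    have hgn : g ∣ n := by
      have := Int.gcd_dvd_right k (n : ℤ)
      exact_mod_cast this
    obtain ⟨c, hc⟩ := Int.gcd_dvd_left k (n : ℤ)
    refine hpow g (by omega) (Nat.le_of_dvd (by omega) hgn) (U ^ c) ?_
    rw [← zpow_natCast, ← zpow_mul]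
    congr 1
    rw [mul_comm]
    exact hc.symm
  obtain ⟨x, y, hxy⟩ := hcop
  -- b = k * (b*x) + n * (b*y)
  refine ⟨(b * x) % n, ?_, U ^ (b * y + k * ((b * x) / n)), ?_, ?_⟩
  · have h0 := Int.emod_nonneg (b * x) (b := (n : ℤ)) (by omega)
    have h1 := Int.emod_lt_of_pos (b * x) (b := (n : ℤ)) (by omega)
    rw [abs_of_nonneg h0]; omega
  · rw [← zpow_add, ← zpow_add, add_comm]
  · rw [← zpow_natCast, ← zpow_mul, ← zpow_mul, ← zpow_add]
    congr 1
    have := Int.emod_add_mul_ediv (b * x) n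
    have h3 : (b * x) % n = b * x - n * ((b * x) / n) := by linarith
    rw [h3]
    linear_combination (-b) * hxy
end FAP
end

section
namespace FAP

def chi4 (a : Fin 4 → ℤ) : F4 →* Multiplicative ℤ :=
  FreeGroup.lift fun i => Multiplicative.ofAdd (a i)

theorem root_basis (i : Fin 4) : IsRootEl (FreeGroup.of i : F4) := by
  apply isRootEl_of_hom (chi4 fun _ => 1)
  simp [chi4]

theorem not_conjComm_basis {i j : Fin 4} (hij : i ≠ j) :
    ¬ ConjComm (FreeGroup.of i : F4) (FreeGroup.of j) := by
  rintro ⟨k, hk⟩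
  obtain ⟨m, hm⟩ := (root_basis i).2 _ hk
  have := congrArg (chi4 fun t => if t = j then 1 else 0) hm
  simp only [map_mul, map_inv, map_zpow] at this
  simp [chi4, hij] at this

section
variable {B : Type} [Group B]

theorem ConjComm.map {G H : Type} [Group G] [Group H] (r : G →* H) {x y : G} (h : ConjComm x y) :
    ConjComm (r x) (r y) := by
  obtain ⟨k, hk⟩ := h
  exact ⟨r k, by simpa using congrArg r hk⟩

theorem lemD (hB : ∀ n, 1 ≤ n → Tau B n) (r : B →* F4) (z w : B) (hz : IsRootEl (r z))
    (hzw : z * w = w * z) (b : ℤ) (hb : r w = r z ^ b) (n : ℕ) (hn : 1 ≤ n) :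
    ∃ s, z * s = s * z ∧ w = z ^ b * s ^ n := by
  obtain ⟨i, -, s, hs, hw⟩ := hB n hn z w hzw (fun m hm _ s hs => hz.not_pow hm (r s) (by
    rw [← map_pow, hs]))
  obtain ⟨c, hc⟩ := hz.2 (r s) (by
    show r z * r s = r s * r z
    rw [← map_mul, hs, map_mul])
  have hbi : b = i + c * n := by
    apply zpow_inj hz.1
    rw [← hb, hw, map_mul, map_zpow, map_pow, hc, ← zpow_natCast, ← zpow_mul, ← zpow_add]
  have hcomm : Commute z s := hs
  refine ⟨z ^ (-c) * s, ((Commute.refl z).zpow_right (-c)).mul_right hcomm, ?_⟩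
  rw [(hcomm.zpow_left (-c)).mul_pow, ← zpow_natCast (z ^ (-c)), ← zpow_mul, ← mul_assoc,
    ← zpow_add, hw, hbi]
  congr 2
  ring

theorem psi_false (hB : ∀ n, 1 ≤ n → Tau B n) (r₁ r₂ : B →* F4) (z z' : B)
    (hz : IsRootEl (r₁ z)) (hz' : IsRootEl (r₂ z')) (R : ℕ) (e e' : ℤ)
    (h1 : 100 < |e - e'|) (h2 : 100 < |e + e'|) (h3 : |e - e'| ≤ R) (h4 : |e + e'| ≤ R) :
    ¬ Psi 100 R e e' z z' := by
  rintro ⟨k, u, hzu, hcu, hzc, ⟨j, hj, heq⟩, hR⟩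
  have hZ : IsRootEl (r₂ (k * z' * k⁻¹)) := by
    simpa using hz'.conj (r₂ k)
  set c := k * z' * k⁻¹ with hc
  have cm : ∀ (r : B →* F4) {x y : B}, x * y = y * x → Commute (r x) (r y) := by
    intro r x y h
    show r x * r y = r y * r x
    rw [← map_mul, h, map_mul]
  obtain ⟨b, hb⟩ := hz.2 _ (cm r₁ hzc)
  obtain ⟨d, hd⟩ := hz.2 _ (cm r₁ hzu)
  obtain ⟨a, ha⟩ := hZ.2 _ (cm r₂ hzc.symm)
  have hdiv : ∀ n : ℕ, 1 ≤ n → (n : ℤ) ∣ 1 - a * b := by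
    intro n hn
    obtain ⟨s, hs, hcs⟩ := lemD hB r₁ z c hz hzc b hb n hn
    have hs' : Commute z s := hs
    have hcs' : Commute c s := by
      rw [hcs]
      exact (hs'.zpow_left b).mul_left ((Commute.refl s).pow_left n)
    obtain ⟨t, ht⟩ := hZ.2 _ (cm r₂ hcs'.eq)
    refine ⟨t, ?_⟩
    have : (1 : ℤ) = a * b + t * n := by
      apply zpow_inj hZ.1
      rw [zpow_one]
      conv_lhs => rw [hcs]
      rw [map_mul, map_zpow, map_pow, ha, ht, ← zpow_natCast, ← zpow_mul, ← zpow_mul, ← zpow_add]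
    linarith
  have hab : 1 - a * b = 0 := by
    have := hdiv ((1 - a * b).natAbs + 1) (by omega)
    apply Int.eq_zero_of_abs_lt_dvd this
    push_cast
    rw [Int.abs_eq_natAbs]
    omega
  have hb1 : b = 1 ∨ b = -1 := by
    apply Int.isUnit_iff.1
    exact isUnit_of_dvd_one ⟨a, by linarith⟩
  have hlin : e - e' * b = j * d := by
    apply zpow_inj hz.1
    have := congrArg r₁ heq
    rw [map_mul, map_zpow, map_zpow, map_zpow, hb, hd, ← zpow_mul, ← zpow_mul, ← zpow_add] at this
    rw [mul_comm j d, ← this]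
    congr 1; ring
  have hbig : 100 < |e - e' * b| ∧ |e - e' * b| ≤ R := by
    rcases hb1 with rfl | rfl
    · simpa using ⟨h1, h3⟩
    · simpa using ⟨h2, h4⟩
  have hj0 : j ≠ 0 := by
    rintro rfl
    rw [hlin] at hbig; simp at hbig
  have hd0 : d ≠ 0 := by
    rintro rfl
    rw [hlin] at hbig; simp at hbig
  rw [hlin, abs_mul] at hbig
  have hj1 : 1 ≤ |j| := Int.one_le_abs hj0
  have hd1 : 1 ≤ |d| := Int.one_le_abs hd0
  by_cases hd2 : |d| = 1
  · rw [hd2] at hbig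
    push_cast at hj
    omega
  · obtain ⟨s, hs, hus⟩ := lemD hB r₁ z u hz hzu d hd d.natAbs (by omega)
    have hs' : Commute z s := hs
    have hdR : |d| ≤ R := by nlinarith
    rw [Int.abs_eq_natAbs] at hdR hd2 hd1
    refine hR d.natAbs (by omega) (by omega) (z ^ d.sign * s) ?_
    rw [(hs'.zpow_left _).mul_pow, hus, ← zpow_natCast (z ^ d.sign), ← zpow_mul,
      Int.sign_mul_natAbs]
end

theorem no_amalgam (B : Type) [Group B] (hE : IsElementaryFree B) (hF : Group.FG B)
    (g₁ g₂ : F4 →* B) (h₁ : IsForallEmbedding g₁) (h₂ : IsForallEmbedding g₂)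
    (hcomp : g₁.comp (alph 1000 0) = g₂.comp (alph 3000 0)) : False := by
  obtain ⟨r₁, hr₁⟩ := exists_retraction hF g₁ h₁
  obtain ⟨r₂, hr₂⟩ := exists_retraction hF g₂ h₂
  have hT : ∀ n, 1 ≤ n → Tau B n := fun n hn => (Df.tau n).transfer hE (tau_free n hn)
  have hS : Sig B 100 10000 1000 3000 := (Df.sig 100 10000 1000 3000).transfer hE
    (sig_free _ _ _ (by norm_num) (by norm_num) (by norm_num) (by norm_num))
  have hl : g₁ gll = g₂ gll := by
    have := DFunLike.congr_fun hcomp gl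
    simpa [alph0_l] using this
  have hc : g₁ (fC 1000) = g₂ (fC 3000) := by
    have := DFunLike.congr_fun hcomp gc
    simpa [alph0_c] using this
  have hsig := hS (g₁ gx) (g₁ gy) (g₁ gh) (g₁ gll) (g₂ gx) (g₂ gy) (g₂ gh) (by
    unfold fC at hc
    simp only [map_mul, map_zpow, map_inv] at hc
    rw [← hl] at hc
    exact_mod_cast hc)
  have k1 : ∀ i, IsRootEl (r₁ (g₁ (FreeGroup.of i))) := fun i => by rw [hr₁]; exact root_basis i
  have k2 : ∀ i, IsRootEl (r₂ (g₂ (FreeGroup.of i))) := fun i => by rw [hr₂]; exact root_basis i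
  rcases hsig with h | h | h | h | h | h
  · have := h.map r₁
    rw [hr₁, hr₁] at this
    exact not_conjComm_basis (by decide) this
  · have := h.map r₂
    rw [hr₂, hr₂] at this
    exact not_conjComm_basis (by decide) this
  · exact psi_false hT r₁ r₂ _ _ (k1 0) (k2 0) _ _ _ (by norm_num) (by norm_num) (by norm_num) (by norm_num) h
  · exact psi_false hT r₁ r₂ _ _ (k1 0) (k2 1) _ _ _ (by norm_num) (by norm_num) (by norm_num) (by norm_num) h
  · exact psi_false hT r₁ r₂ _ _ (k1 1) (k2 0) _ _ _ (by norm_num) (by norm_num) (by norm_num) (by norm_num) h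
  · exact psi_false hT r₁ r₂ _ _ (k1 1) (k2 1) _ _ _ (by norm_num) (by norm_num) (by norm_num) (by norm_num) h

theorem alph_forallEmb (p : ℕ) (hp : 2 ≤ p) : IsForallEmbedding (alph p 0) :=
  forallEmb_of_retract _ fun S hS h1 => retract_discriminate p hp S hS h1

theorem nonab_free (n : ℕ) (i j : Fin n) (hij : i ≠ j) : Nonabelian (FreeGroup (Fin n)) := by
  refine ⟨FreeGroup.of i, FreeGroup.of j, fun h => ?_⟩
  have := congrArg FreeGroup.toWord h
  simp [FreeGroup.toWord_mul, FreeGroup.toWord_of, FreeGroup.reduce] at this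
  exact hij this.1
theorem main_thm :
    ∃ (A₀ A₁ A₂ : BGroup),
      (IsFreeGroup A₀ ∧ Group.FG A₀ ∧ Nonabelian A₀) ∧
      (IsFreeGroup A₁ ∧ Group.FG A₁ ∧ Nonabelian A₁) ∧
      (IsFreeGroup A₂ ∧ Group.FG A₂ ∧ Nonabelian A₂) ∧
      ∃ (f₁ : A₀.carrier →* A₁.carrier) (f₂ : A₀.carrier →* A₂.carrier),
        IsForallEmbedding f₁ ∧ IsForallEmbedding f₂ ∧
        ¬ ∃ (B : BGroup), IsElementaryFree B ∧ Group.FG B ∧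
            ∃ (g₁ : A₁.carrier →* B.carrier) (g₂ : A₂.carrier →* B.carrier),
              IsForallEmbedding g₁ ∧ IsForallEmbedding g₂ ∧ g₁.comp f₁ = g₂.comp f₂ := by
  have fg : ∀ n, Group.FG (FreeGroup (Fin n)) := fun n => inferInstance
  have n4 : Nonabelian F4 := nonab_free 4 0 1 (by decide)
  refine ⟨⟨F2⟩, ⟨F4⟩, ⟨F4⟩, ⟨inferInstanceAs (IsFreeGroup F2), fg 2, nonab_free 2 0 1 (by decide)⟩,
    ⟨inferInstanceAs (IsFreeGroup F4), fg 4, n4⟩, ⟨inferInstanceAs (IsFreeGroup F4), fg 4, n4⟩,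
    alph 1000 0, alph 3000 0, alph_forallEmb 1000 (by norm_num), alph_forallEmb 3000 (by norm_num), ?_⟩
  rintro ⟨B, hE, hF, g₁, g₂, h₁, h₂, hc⟩
  exact no_amalgam B hE hF g₁ g₂ h₁ h₂ hc
end FAP
end

/-- The `∀`-amalgamation property fails for finitely generated elementary free groups: there are
finitely generated nonabelian free groups `A₀, A₁, A₂` and `∀`-embeddings `f₁ : A₀ → A₁`,
`f₂ : A₀ → A₂` that cannot be completed by `∀`-embeddings into any finitely generated
elementary free group.  In particular, the class of finitely generated elementary free groups
is not a `∀`-Fraïssé class. -/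
theorem fg_elementary_free_groups_not_forall_amalgamation :
    ∃ (A₀ A₁ A₂ : BGroup),
      (IsFreeGroup A₀ ∧ Group.FG A₀ ∧ Nonabelian A₀) ∧
      (IsFreeGroup A₁ ∧ Group.FG A₁ ∧ Nonabelian A₁) ∧
      (IsFreeGroup A₂ ∧ Group.FG A₂ ∧ Nonabelian A₂) ∧
      ∃ (f₁ : A₀.carrier →* A₁.carrier) (f₂ : A₀.carrier →* A₂.carrier),
        IsForallEmbedding f₁ ∧ IsForallEmbedding f₂ ∧
        ¬ ∃ (B : BGroup), IsElementaryFree B ∧ Group.FG B ∧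
            ∃ (g₁ : A₁.carrier →* B.carrier) (g₂ : A₂.carrier →* B.carrier),
              IsForallEmbedding g₁ ∧ IsForallEmbedding g₂ ∧ g₁.comp f₁ = g₂.comp f₂ := by
  exact FAP.main_thm
end

section
/- The strong ∀-amalgamation property fails for nonabelian limit groups: there exist nonabelian limit groups A₀, A₁, A₂, a finite tuple ā in A₀, and partial ∀-embeddings f₁ of ā into A₁ and f₂ of ā into A₂ (maps of the tuple ā to tuples in A₁ resp. A₂ such that every universal formula satisfied by ā in A₀ is satisfied by its image) such that there is no nonabelian limit group B admitting ∀-embeddings g₁ : A₁ → B and g₂ : A₂ → B with g₁(f₁(ā)) = g₂(f₂(ā)). In particular, the class of nonabelian limit groups is not a strong ∀-Fraïssé class. -/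
open FirstOrder

/-- A finitely generated group is a limit group (fully residually free) if every finite set of
nontrivial elements can be mapped to nontrivial elements by some homomorphism to a free
group. -/
def IsLimitGroup (G : Type*) [Group G] : Prop :=
  Group.FG G ∧
    ∀ (k : ℕ) (g : Fin k → G), (∀ i, g i ≠ 1) →
      ∃ (ι : Type) (φ : G →* FreeGroup ι), ∀ i, φ (g i) ≠ 1

/-- Doubling every letter of a word. -/
def dblWord (L : List (Fin 2 × Bool)) : List (Fin 2 × Bool) := L.flatMap fun p => [p, p]

theorem dblWord_isReduced : ∀ L : List (Fin 2 × Bool),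
    FreeGroup.IsReduced L → FreeGroup.IsReduced (dblWord L)
  | [], _ => by simp [dblWord]
  | [a], _ => by simp [dblWord]
  | a :: b :: L, h => by
    have h' := FreeGroup.isReduced_cons_cons.1 h
    have ih := dblWord_isReduced (b :: L) h'.2
    simp only [dblWord, List.flatMap_cons, List.cons_append, List.nil_append] at ih ⊢
    exact FreeGroup.isReduced_cons_cons.2
      ⟨fun _ => rfl, FreeGroup.isReduced_cons_cons.2 ⟨h'.1, ih⟩⟩

/-- The endomorphism squaring every generator. -/
def sqHom : FreeGroup (Fin 2) →* FreeGroup (Fin 2) :=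
  FreeGroup.lift fun i => FreeGroup.of i * FreeGroup.of i

theorem sqHom_mk (L : List (Fin 2 × Bool)) :
    sqHom (FreeGroup.mk L) = FreeGroup.mk (dblWord L) := by
  induction L with
  | nil => rfl
  | cons a L ih =>
    have h1 : FreeGroup.mk (a :: L) = FreeGroup.mk [a] * FreeGroup.mk L := by
      simp
    have h2 : FreeGroup.mk (dblWord (a :: L)) = FreeGroup.mk [a, a] * FreeGroup.mk (dblWord L) := by
      simp [dblWord]
    rw [h1, h2, map_mul, ih]
    congr 1
    obtain ⟨i, b⟩ := a
    cases b <;> simp [sqHom, FreeGroup.of, FreeGroup.invRev]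

theorem sqHom_injective : Function.Injective sqHom := by
  rw [injective_iff_map_eq_one]
  intro w hw
  rw [← FreeGroup.mk_toWord (x := w), sqHom_mk] at hw
  have hr := dblWord_isReduced _ (FreeGroup.isReduced_toWord (x := w))
  have h3 := congrArg FreeGroup.toWord hw
  rw [FreeGroup.toWord_mk, hr.reduce_eq, FreeGroup.toWord_one] at h3
  rw [← FreeGroup.toWord_eq_nil_iff]
  cases h : w.toWord with
  | nil => rfl
  | cons a L => rw [h] at h3; simp [dblWord] at h3

/-- An injective group homomorphism is an embedding of structures. -/
def homEmbedding {G H : Type*} [Group G] [Group H] (f : G →* H)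
    (hf : Function.Injective f) : G ↪[Lgp] H where
  toFun := f
  inj' := hf
  map_fun' := by
    intro n F x
    cases F
    · exact map_one f
    · exact map_inv f _
    · exact map_mul f _ _
  map_rel' := by
    intro n r
    exact r.elim

theorem realize_alls_of_embedding {G H : Type*} [Group G] [Group H] (f : G →* H)
    (hf : Function.Injective f) {k : ℕ} (φ : Lgp.Formula (Fin k)) (hφ : IsUniversalF φ)
    (v : Fin k → G) (h : φ.Realize (f ∘ v)) : φ.Realize v := by
  obtain ⟨n, ψ, hψ, rfl⟩ := hφ
  rw [Language.BoundedFormula.realize_alls] at h ⊢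
  intro xs
  exact (hψ.realize_embedding (homEmbedding f hf)).1 (h (f ∘ xs))

/-- The bounded formula `z * z ≠ x` with free variable `x` and bound variable `z`. -/
def notSqQF : Lgp.BoundedFormula (Fin 1) 1 :=
  (Language.Term.bdEqual
    (Language.Term.func (L := Lgp) (l := 2) GroupFn.mul ![.var (.inr 0), .var (.inr 0)])
    (.var (.inl 0))).not

theorem notSq_universal : IsUniversalF notSqQF.alls :=
  ⟨1, notSqQF, (Language.BoundedFormula.IsAtomic.equal _ _).isQF.not, rfl⟩

theorem notSq_realize {G : Type*} [Group G] (v : Fin 1 → G) :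
    Language.Formula.Realize notSqQF.alls v ↔ ∀ z : G, z * z ≠ v 0 := by
  have key : ∀ xs : Fin 1 → G, notSqQF.Realize v xs ↔ xs 0 * xs 0 ≠ v 0 := by
    intro xs
    exact Iff.rfl
  rw [Language.BoundedFormula.realize_alls]
  constructor
  · intro h z
    exact (key fun _ => z).1 (h _)
  · intro h xs
    exact (key xs).2 (h _)

theorem of_not_square (z : FreeGroup (Fin 2)) : z * z ≠ FreeGroup.of 0 := by
  intro h
  have h2 := congrArg
    (fun w => Multiplicative.toAdd (FreeGroup.lift (fun _ => Multiplicative.ofAdd (1 : ℤ)) w)) h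
  simp only [map_mul, FreeGroup.lift_apply_of, toAdd_mul, toAdd_ofAdd] at h2
  omega

theorem free_limit : IsLimitGroup (FreeGroup (Fin 2)) :=
  ⟨inferInstance, fun _ _ hg => ⟨Fin 2, MonoidHom.id _, hg⟩⟩

theorem free_nonabelian : Nonabelian (FreeGroup (Fin 2)) :=
  ⟨FreeGroup.of 0, FreeGroup.of 1, by decide⟩

/-- The strong `∀`-amalgamation property fails for nonabelian limit groups: there are nonabelian
limit groups `A₀, A₁, A₂`, a tuple `a` in `A₀`, and partial `∀`-embeddings of `a` into `A₁` and
`A₂` (tuples `b₁`, `b₂` satisfying every universal formula that `a` satisfies) which cannot be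
completed by `∀`-embeddings into any nonabelian limit group.  In particular, the class of
nonabelian limit groups is not a strong `∀`-Fraïssé class. -/
theorem limit_groups_not_strong_forall_amalgamation :
    ∃ (A₀ A₁ A₂ : BGroup),
      (IsLimitGroup A₀ ∧ Nonabelian A₀) ∧
      (IsLimitGroup A₁ ∧ Nonabelian A₁) ∧
      (IsLimitGroup A₂ ∧ Nonabelian A₂) ∧
      ∃ (k : ℕ) (a : Fin k → A₀.carrier) (b₁ : Fin k → A₁.carrier) (b₂ : Fin k → A₂.carrier),
        (∀ φ : Lgp.Formula (Fin k), IsUniversalF φ → φ.Realize a → φ.Realize b₁) ∧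
        (∀ φ : Lgp.Formula (Fin k), IsUniversalF φ → φ.Realize a → φ.Realize b₂) ∧
        ¬ ∃ (B : BGroup), IsLimitGroup B ∧ Nonabelian B ∧
            ∃ (g₁ : A₁.carrier →* B.carrier) (g₂ : A₂.carrier →* B.carrier),
              IsForallEmbedding g₁ ∧ IsForallEmbedding g₂ ∧
              ∀ i, g₁ (b₁ i) = g₂ (b₂ i) := by
  refine ⟨⟨FreeGroup (Fin 2)⟩, ⟨FreeGroup (Fin 2)⟩, ⟨FreeGroup (Fin 2)⟩,
    ⟨free_limit, free_nonabelian⟩, ⟨free_limit, free_nonabelian⟩, ⟨free_limit, free_nonabelian⟩,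
    1, fun _ => FreeGroup.of 0 * FreeGroup.of 0, fun _ => FreeGroup.of 0 * FreeGroup.of 0,
    fun _ => FreeGroup.of 0, fun _ _ h => h, ?_, ?_⟩
  · intro φ hφ h
    refine realize_alls_of_embedding sqHom sqHom_injective φ hφ _ ?_
    convert h using 1
    funext i
    simp [sqHom]
  · rintro ⟨B, -, -, g₁, g₂, -, hg₂, hg⟩
    have h := hg₂.2 1 _ notSq_universal (fun _ => FreeGroup.of 0)
      ((notSq_realize _).2 of_not_square)
    refine (notSq_realize _).1 h (g₁ (FreeGroup.of 0)) ?_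
    have := hg 0
    rw [map_mul] at this
    exact this
end

section
/- Let F be a free group with a fixed finite basis, let u and v be cyclically reduced words, and suppose w is a subword of u^{n₁} and also a subword of v^{n₂} for some integers n₁, n₂. If |w| ≥ |u| + |v|, then there exist words a₁ and a₂ that are cyclic shifts of one another and integers k₁, k₂ such that u = a₁^{k₁} and v = a₂^{k₂}. In particular, u commutes with some conjugate of v in F. -/
/-- An element of a free group is cyclically reduced if its square has twice its length. -/
def IsCyclicallyReduced {α : Type} [DecidableEq α] (w : FreeGroup α) : Prop :=
  (w * w).norm = 2 * w.norm

/-- `w` is a subword of `v` if the reduced word of `w` occurs as a contiguous block of the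
reduced word of `v`. -/
def IsSubwordOf {α : Type} [DecidableEq α] (w v : FreeGroup α) : Prop :=
  ∃ p s : List (α × Bool), v.toWord = p ++ w.toWord ++ s

/-- Two elements of a free group are cyclic shifts of one another if their reduced words are
obtained from each other by a cyclic shift. -/
def AreCyclicShifts {α : Type} [DecidableEq α] (a₁ a₂ : FreeGroup α) : Prop :=
  ∃ p s : List (α × Bool), a₁.toWord = p ++ s ∧ a₂.toWord = s ++ p

namespace SubwordProof

theorem getElem?_flatten_replicate {β : Type} (U : List β) (n m : ℕ)
    (h : m < n * U.length) : (List.replicate n U).flatten[m]? = U[m % U.length]? := by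
  induction n generalizing m with
  | zero => simp at h
  | succ n ih =>
    rw [List.replicate_succ, List.flatten_cons, List.getElem?_append]
    split_ifs with hm
    · rw [Nat.mod_eq_of_lt hm]
    · push Not at hm
      rw [ih _ (by rw [Nat.add_mul] at h; omega), Nat.mod_eq_sub_mod hm]

/-- A factor of a power of `U` reads off `U` cyclically. -/
theorem factor_getElem? {β : Type} (U X p s : List β) (n : ℕ)
    (h : (List.replicate n U).flatten = p ++ X ++ s) (j : ℕ) (hj : j < X.length) :
    X[j]? = U[(p.length + j) % U.length]? := by
  have hl : p.length + j < n * U.length := by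
    have := congrArg List.length h
    simp at this
    omega
  rw [← getElem?_flatten_replicate U n _ hl, h, List.append_assoc,
    List.getElem?_append_right (by omega), List.getElem?_append_left (by omega)]
  congr 1; omega

theorem factor_hasPeriod {β : Type} (U X p s : List β) (n : ℕ)
    (h : (List.replicate n U).flatten = p ++ X ++ s) : X.HasPeriod U.length := by
  rw [List.hasPeriod_iff_getElem?]
  intro i hi
  rw [factor_getElem? U X p s n h i (by omega), factor_getElem? U X p s n h _ (by omega),
    ← add_assoc, Nat.add_mod_right]

theorem power_of_rotate {β : Type} (U X p s : List β) (n d : ℕ) (hU : U ≠ [])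
    (h : (List.replicate n U).flatten = p ++ X ++ s) (hlen : U.length ≤ X.length)
    (hd : d ∣ U.length) (hX : X.HasPeriod d) :
    ∃ e k : ℕ, k ≠ 0 ∧ U = (List.replicate k ((X.take d).rotate e)).flatten := by
  have hp : 0 < U.length := List.length_pos_iff.2 hU
  have hd0 : 0 < d := Nat.pos_of_dvd_of_pos hd hp
  have hdle : d ≤ U.length := Nat.le_of_dvd hp hd
  have hA : (X.take d).length = d := by simp; omega
  set P := U.length with hP
  obtain ⟨c, hc⟩ := hd
  -- `e ≡ -|p|` modulo `|U|`
  have he : (p.length + (P - p.length % P)) % P = 0 := by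
    have h1 := Nat.mod_lt p.length hp
    have h2 := Nat.mod_add_div p.length P
    have : p.length + (P - p.length % P) = P * (p.length / P + 1) := by
      rw [mul_add]; omega
    rw [this]; simp
  refine ⟨P - p.length % P, c, by rintro rfl; omega, ?_⟩
  set e := P - p.length % P
  apply List.ext_getElem?
  intro m
  by_cases hm : m < P
  · rw [getElem?_flatten_replicate _ _ _ (by rw [List.length_rotate, hA, mul_comm, ← hc]; exact hm)]
    rw [List.length_rotate, hA, List.getElem?_rotate (by rw [hA]; exact Nat.mod_lt _ hd0), hA,
      List.getElem?_take_of_lt (Nat.mod_lt _ hd0), Nat.mod_add_mod]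
    have hlt : (m + e) % P < X.length := lt_of_lt_of_le (Nat.mod_lt _ hp) hlen
    have h1 := factor_getElem? U X p s n h ((m + e) % P) hlt
    rw [List.hasPeriod_iff_forall_getElem?_mod.1 hX _ hlt, Nat.mod_mod_of_dvd _ ⟨c, hc⟩] at h1
    rw [h1, ← hP, Nat.add_mod_mod, show p.length + (m + e) = m + (p.length + e) by ring,
      Nat.add_mod, he, add_zero, Nat.mod_mod, Nat.mod_eq_of_lt hm]
  · rw [List.getElem?_eq_none (by omega), List.getElem?_eq_none]
    rw [List.length_flatten]
    simp
    rw [min_eq_left (by omega), mul_comm, ← hc]; omega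

variable {α : Type} [DecidableEq α]

theorem cycRed {u : FreeGroup α} (hu : IsCyclicallyReduced u) :
    FreeGroup.IsCyclicallyReduced u.toWord := by
  have h1 := FreeGroup.toWord_mul_sublist u u
  have h2 : (u * u).toWord = u.toWord ++ u.toWord := by
    apply h1.eq_of_length
    have : (u * u).toWord.length = 2 * u.toWord.length := hu
    rw [this]; simp; omega
  have h3 : FreeGroup.IsReduced (u.toWord ++ u.toWord) := h2 ▸ FreeGroup.isReduced_toWord
  unfold FreeGroup.IsReduced at h3
  rw [List.isChain_append] at h3
  exact ⟨h3.1, h3.2.2⟩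

theorem toWord_pow' {u : FreeGroup α} (hu : IsCyclicallyReduced u) (n : ℕ) :
    (u ^ n).toWord = (List.replicate n u.toWord).flatten := by
  rw [FreeGroup.toWord_pow]
  exact ((cycRed hu).flatten_replicate n).isReduced.reduce_eq

theorem cycRed_inv {u : FreeGroup α} (hu : IsCyclicallyReduced u) : IsCyclicallyReduced u⁻¹ := by
  unfold IsCyclicallyReduced at *
  rw [← mul_inv_rev, FreeGroup.norm_inv_eq, FreeGroup.norm_inv_eq, hu]

theorem mk_flatten (A : List (α × Bool)) (k : ℕ) :
    FreeGroup.mk (List.replicate k A).flatten = FreeGroup.mk A ^ k := by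
  rw [FreeGroup.pow_mk]

theorem root_word {u : FreeGroup α} {B : List (α × Bool)} {k : ℕ} (hk : k ≠ 0)
    (h : u.toWord = (List.replicate k B).flatten) :
    (FreeGroup.mk B).toWord = B ∧ u = FreeGroup.mk B ^ k := by
  constructor
  · rw [FreeGroup.toWord_mk]
    apply FreeGroup.IsReduced.reduce_eq
    have h3 : FreeGroup.IsReduced u.toWord := FreeGroup.isReduced_toWord
    obtain ⟨k, rfl⟩ := Nat.exists_eq_succ_of_ne_zero hk
    rw [h, List.replicate_succ, List.flatten_cons] at h3
    exact h3.infix ⟨[], _, by simp; rfl⟩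
  · rw [← mk_flatten, ← h, FreeGroup.mk_toWord]

theorem main_nat (u v w : FreeGroup α) (hu : IsCyclicallyReduced u) (hv : IsCyclicallyReduced v)
    (n₁ n₂ : ℕ) (hw₁ : IsSubwordOf w (u ^ n₁)) (hw₂ : IsSubwordOf w (v ^ n₂))
    (hlen : u.norm + v.norm ≤ w.norm) :
    ∃ a₁ a₂ : FreeGroup α, AreCyclicShifts a₁ a₂ ∧
      ∃ k₁ k₂ : ℤ, u = a₁ ^ k₁ ∧ v = a₂ ^ k₂ := by
  obtain ⟨p, s, h₁⟩ := hw₁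
  obtain ⟨p', s', h₂⟩ := hw₂
  rw [toWord_pow' hu] at h₁
  rw [toWord_pow' hv] at h₂
  have hlen' : u.toWord.length + v.toWord.length ≤ w.toWord.length := hlen
  by_cases hu1 : u.toWord = []
  · have hw : w.toWord.length = 0 := by
      have := congrArg List.length h₁
      simp [hu1] at this; omega
    have hv1 : v.toWord = [] := List.length_eq_zero_iff.1 (by omega)
    rw [FreeGroup.toWord_eq_nil_iff] at hu1 hv1
    exact ⟨1, 1, ⟨[], [], by simp⟩, 1, 1, by simp [hu1, hv1]⟩
  by_cases hv1 : v.toWord = []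
  · have hw : w.toWord.length = 0 := by
      have := congrArg List.length h₂
      simp [hv1] at this; omega
    exact absurd (List.length_eq_zero_iff.1 (by omega)) hu1
  have hper := (factor_hasPeriod _ _ _ _ _ h₁).gcd (factor_hasPeriod _ _ _ _ _ h₂) (by omega)
  obtain ⟨e, k, hk, hU⟩ := power_of_rotate _ _ _ _ _ _ hu1 h₁ (by omega)
    (Nat.gcd_dvd_left _ _) hper
  obtain ⟨e', k', hk', hV⟩ := power_of_rotate _ _ _ _ _ _ hv1 h₂ (by omega)
    (Nat.gcd_dvd_right _ _) hper
  set A := w.toWord.take (u.toWord.length.gcd v.toWord.length)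
  obtain ⟨hr, hup⟩ := root_word hk hU
  obtain ⟨hr', hvp⟩ := root_word hk' hV
  refine ⟨_, _, ?_, (k : ℤ), (k' : ℤ), by rw [zpow_natCast]; exact hup,
    by rw [zpow_natCast]; exact hvp⟩
  have hrot : A.rotate e ~r A.rotate e' :=
    (List.IsRotated.symm ⟨e, rfl⟩).trans ⟨e', rfl⟩
  obtain ⟨m, hm, hm'⟩ := List.isRotated_iff_mod.1 hrot
  refine ⟨(A.rotate e).take m, (A.rotate e).drop m, ?_, ?_⟩
  · rw [hr, List.take_append_drop]
  · rw [hr', ← hm', List.rotate_eq_drop_append_take hm]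

theorem to_nat (u w : FreeGroup α) (hu : IsCyclicallyReduced u) (n : ℤ)
    (hw : IsSubwordOf w (u ^ n)) : ∃ (u' : FreeGroup α) (m : ℕ), IsCyclicallyReduced u' ∧
      IsSubwordOf w (u' ^ m) ∧ u'.norm = u.norm ∧ (u = u' ^ (1 : ℤ) ∨ u = u' ^ (-1 : ℤ)) := by
  obtain ⟨m, rfl | rfl⟩ := n.eq_nat_or_neg
  · exact ⟨u, m, hu, by simpa using hw, rfl, by simp⟩
  · exact ⟨u⁻¹, m, cycRed_inv hu, by simpa using hw, FreeGroup.norm_inv_eq, by simp⟩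

end SubwordProof

/-- If `u` and `v` are cyclically reduced words in a free group of finite rank and some word `w`
of length at least `|u| + |v|` is a subword of both a power of `u` and a power of `v`, then `u`
and `v` are powers `a₁^{k₁}` and `a₂^{k₂}` of words `a₁, a₂` that are cyclic shifts of one
another; in particular `u` commutes with a conjugate of `v`. -/
theorem subword_of_two_powers {α : Type} [Fintype α] [DecidableEq α]
    (u v w : FreeGroup α) (hu : IsCyclicallyReduced u) (hv : IsCyclicallyReduced v)
    (n₁ n₂ : ℤ) (hw₁ : IsSubwordOf w (u ^ n₁)) (hw₂ : IsSubwordOf w (v ^ n₂))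
    (hlen : u.norm + v.norm ≤ w.norm) :
    ∃ a₁ a₂ : FreeGroup α, AreCyclicShifts a₁ a₂ ∧
      (∃ k₁ k₂ : ℤ, u = a₁ ^ k₁ ∧ v = a₂ ^ k₂) ∧
      ∃ g : FreeGroup α, Commute u (g * v * g⁻¹) := by
  obtain ⟨u', m₁, hu', hs₁, hn₁, hue⟩ := SubwordProof.to_nat u w hu n₁ hw₁
  obtain ⟨v', m₂, hv', hs₂, hn₂, hve⟩ := SubwordProof.to_nat v w hv n₂ hw₂
  obtain ⟨a₁, a₂, hsh, k₁, k₂, hk₁, hk₂⟩ :=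
    SubwordProof.main_nat u' v' w hu' hv' m₁ m₂ hs₁ hs₂ (by omega)
  have hu2 : ∃ k : ℤ, u = a₁ ^ k := by
    rcases hue with h | h <;> exact ⟨_, by rw [h, hk₁, ← zpow_mul]⟩
  have hv2 : ∃ k : ℤ, v = a₂ ^ k := by
    rcases hve with h | h <;> exact ⟨_, by rw [h, hk₂, ← zpow_mul]⟩
  obtain ⟨l₁, hl₁⟩ := hu2
  obtain ⟨l₂, hl₂⟩ := hv2
  refine ⟨a₁, a₂, hsh, ⟨l₁, l₂, hl₁, hl₂⟩, ?_⟩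
  obtain ⟨p, s, hp, hs⟩ := hsh
  have e₁ : a₁ = FreeGroup.mk p * FreeGroup.mk s := by
    rw [FreeGroup.mul_mk, ← hp, FreeGroup.mk_toWord]
  have e₂ : a₂ = FreeGroup.mk s * FreeGroup.mk p := by
    rw [FreeGroup.mul_mk, ← hs, FreeGroup.mk_toWord]
  refine ⟨FreeGroup.mk p, ?_⟩
  have e₃ : FreeGroup.mk p * a₂ * (FreeGroup.mk p)⁻¹ = a₁ := by rw [e₁, e₂]; group
  rw [hl₁, hl₂, ← conj_zpow, e₃]
  exact (Commute.refl a₁).zpow_zpow _ _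
end
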